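/- arXiv:2110.07037 — 2 statements merged into one kernel-verified Lean document; each statement's English description precedes it below -/
import Mathlib

section
/- Stability lemma, improved estimate for split boundary data (1D, isotropic scattering): assume σ_min ≤ σ_s(x) ≤ σ_max and 0 ≤ σ_a(x) ≤ σ_max on [0,1] with 0 < σ_min ≤ σ_max. There exists a constant C > 0, depending only on σ_min and σ_max (independent of ε), such that for every ε ∈ (0,1], every ξ ∈ C([0,1]), every η ∈ C(Ω) with ⟨η⟩ ≡ 0, every ζ₁ ∈ C¹([0,1]) and ζ₂ defined on the inflow boundary, and every f ∈ C¹(Ω) satisfying ε v ∂_x f = σ_s(⟨f⟩ − f) − ε² σ_a f + ε² ξ(x) + ε η(x,v) on Ω with f(0,v) = ζ₁(0) + ε ζ₂(0,v) for v ∈ (0,1] and f(1,v) = ζ₁(1) + ε ζ₂(1,v) for v ∈ [−1,0), one has ∫₀¹∫_{−1}^{1} f² dv dx ≤ C ( ∫₀¹ ξ² dx + ∫₀¹∫_{−1}^{1} η² dv dx + ζ₁(0)² + ζ₁(1)² + ∫₀¹ ζ₁′(x)² dx + ε ( ∫₀¹ ζ₂(0,v)² dv + ∫_{−1}^{0} ζ₂(1,v)²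 dv ) ). In particular the stability constant stays bounded as ε ↓ 0. -/
open MeasureTheory Set Function

/-- Velocity average `⟨h⟩(x) = (1/2)∫_{-1}^{1} h(x,v) dv`. -/
noncomputable def vavg (h : ℝ → ℝ → ℝ) (x : ℝ) : ℝ := (1/2) * ∫ v in (-1:ℝ)..1, h x v

/-- `f ∈ C¹(Ω)` with `Ω = [0,1] × [−1,1]`. -/
def C1Omega (f : ℝ → ℝ → ℝ) : Prop :=
  ContDiffOn ℝ 1 (uncurry f) (Icc (0:ℝ) 1 ×ˢ Icc (-1:ℝ) 1)

/-- `f` solves the 1D RTE `ε v ∂_x f = σ_s(⟨f⟩ − f) − ε² σ_a f + ε² G` on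
`Ω = [0,1] × [−1,1]` with inflow boundary data `φ`. -/
def SolvesRTE (ε : ℝ) (σs σa G : ℝ → ℝ) (φ f : ℝ → ℝ → ℝ) : Prop :=
  (∀ x ∈ Icc (0:ℝ) 1, ∀ v ∈ Icc (-1:ℝ) 1,
    ε * v * deriv (fun y => f y v) x
      = σs x * (vavg f x - f x v) - ε ^ 2 * σa x * f x v + ε ^ 2 * G x) ∧
  (∀ v ∈ Ioc (0:ℝ) 1, f 0 v = φ 0 v) ∧
  (∀ v ∈ Ico (-1:ℝ) 0, f 1 v = φ 1 v)

/-- The pair `(ρ, g)` solves the macro–micro system: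
`⟨v ∂_x g⟩ = −σ_a ρ + G` on `[0,1]`;
`v ∂_x(ρ + ε g) − ε⟨v ∂_x g⟩ = σ_s(⟨g⟩ − g) − ε² σ_a g` on `Ω`;
`ρ(0) + ε g(0,v) = φ(0,v)` for `v ∈ (0,1]` and `ρ(1) + ε g(1,v) = φ(1,v)` for `v ∈ [−1,0)`. -/
def SolvesMM (ε : ℝ) (σs σa G : ℝ → ℝ) (φ : ℝ → ℝ → ℝ)
    (ρ : ℝ → ℝ) (g : ℝ → ℝ → ℝ) : Prop :=
  (∀ x ∈ Icc (0:ℝ) 1,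
    ((1/2) * ∫ v in (-1:ℝ)..1, v * deriv (fun y => g y v) x) = -(σa x) * ρ x + G x) ∧
  (∀ x ∈ Icc (0:ℝ) 1, ∀ v ∈ Icc (-1:ℝ) 1,
    v * deriv (fun y => ρ y + ε * g y v) x
      - ε * ((1/2) * ∫ w in (-1:ℝ)..1, w * deriv (fun y => g y w) x)
      = σs x * (vavg g x - g x v) - ε ^ 2 * σa x * g x v) ∧
  (∀ v ∈ Ioc (0:ℝ) 1, ρ 0 + ε * g 0 v = φ 0 v) ∧
  (∀ v ∈ Ico (-1:ℝ) 0, ρ 1 + ε * g 1 v = φ 1 v)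

/-- Cauchy–Schwarz against the constant function. -/
lemma sq_intervalIntegral_le {g : ℝ → ℝ} (hg : Continuous g) {a b : ℝ} (hab : a ≤ b) :
    (∫ x in a..b, g x) ^ 2 ≤ (b - a) * ∫ x in a..b, (g x) ^ 2 := by
  rcases hab.eq_or_lt with rfl | hlt
  · simp
  set m := ∫ x in a..b, g x with hm
  have h0 : 0 ≤ ∫ x in a..b, ((b - a) * g x - m) ^ 2 :=
    intervalIntegral.integral_nonneg hab fun x _ => sq_nonneg _
  have h1 : (∫ x in a..b, ((b - a) * g x - m) ^ 2)
      = (b - a) ^ 2 * (∫ x in a..b, (g x) ^ 2) - 2 * (b - a) * m * m + (b - a) * m ^ 2 := by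
    have : ∀ x, ((b - a) * g x - m) ^ 2
        = (b - a) ^ 2 * (g x) ^ 2 - 2 * (b - a) * m * g x + m ^ 2 := fun x => by ring
    simp_rw [this]
    rw [intervalIntegral.integral_add, intervalIntegral.integral_sub,
      intervalIntegral.integral_const_mul, intervalIntegral.integral_const_mul,
      intervalIntegral.integral_const, ← hm, smul_eq_mul]
    all_goals exact Continuous.intervalIntegrable (by fun_prop) _ _
  rw [h1] at h0
  have h2 : 0 ≤ (b - a) * ((b - a) * (∫ x in a..b, (g x) ^ 2) - m ^ 2) := by linarith
  have := nonneg_of_mul_nonneg_right h2 (sub_pos.2 hlt)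
  linarith

lemma sq_intervalIntegral_mul_le {w g : ℝ → ℝ} (hw : Continuous w) (hg : Continuous g)
    (hw1 : ∀ v ∈ Icc (-1 : ℝ) 1, (w v) ^ 2 ≤ 1) :
    (∫ v in (-1:ℝ)..1, w v * g v) ^ 2 ≤ 2 * ∫ v in (-1:ℝ)..1, (g v) ^ 2 := by
  refine (sq_intervalIntegral_le (hw.mul hg) (by norm_num)).trans ?_
  rw [show (1:ℝ) - -1 = 2 by norm_num]
  gcongr
  refine intervalIntegral.integral_mono_on (by norm_num)
    (Continuous.intervalIntegrable (by fun_prop) _ _)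
    (Continuous.intervalIntegrable (by fun_prop) _ _) fun v hv => ?_
  rw [Pi.mul_apply, mul_pow]
  exact mul_le_of_le_one_left (sq_nonneg _) (hw1 v hv)

lemma sq_le_one_of_mem_Icc {v : ℝ} (hv : v ∈ Icc (-1 : ℝ) 1) : v ^ 2 ≤ 1 := by
  nlinarith [hv.1, hv.2]

lemma integral_sub_mean {u : ℝ → ℝ} (hu : Continuous u) {r : ℝ}
    (hr : r = (1/2) * ∫ v in (-1:ℝ)..1, u v) : (∫ v in (-1:ℝ)..1, (u v - r)) = 0 := by
  rw [intervalIntegral.integral_sub (hu.intervalIntegrable _ _) (by simp)]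
  simp only [intervalIntegral.integral_const, smul_eq_mul]
  linarith

/-- Kinetic energy inequality on a fixed slice `x = const`. -/
lemma slice_energy {σmin ε s a r z δ : ℝ} {u w e : ℝ → ℝ} (hσmin : 0 < σmin)
    (hs : σmin ≤ s) (ha : 0 ≤ a) (hδ : 0 < δ)
    (hu : Continuous u) (hw : Continuous w) (he : Continuous e)
    (hr : r = (1/2) * ∫ v in (-1:ℝ)..1, u v) (he0 : (∫ v in (-1:ℝ)..1, e v) = 0)
    (heq : ∀ v ∈ Icc (-1:ℝ) 1,
      ε * v * w v = s * (r - u v) - ε ^ 2 * a * u v + ε ^ 2 * z + ε * e v) :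
    ε * (∫ v in (-1:ℝ)..1, v * (w v * u v))
      ≤ -(σmin / 2) * (∫ v in (-1:ℝ)..1, (u v - r) ^ 2) + ε ^ 2 * (δ * r ^ 2 + z ^ 2 / δ)
        + ε ^ 2 / (2 * σmin) * ∫ v in (-1:ℝ)..1, (e v) ^ 2 := by
  have hq := integral_sub_mean hu hr
  have hum : (∫ v in (-1:ℝ)..1, u v) = 2 * r := by linarith
  have h1 : (∫ v in (-1:ℝ)..1, ε * (v * (w v * u v)))
      ≤ ∫ v in (-1:ℝ)..1, (-(σmin / 2) * (u v - r) ^ 2 + ε ^ 2 / (2 * σmin) * (e v) ^ 2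
        + (-(s * r)) * (u v - r) + (ε * r) * e v + (ε ^ 2 * z) * u v) := by
    refine intervalIntegral.integral_mono_on (by norm_num)
      (Continuous.intervalIntegrable (by fun_prop) _ _)
      (Continuous.intervalIntegrable (by fun_prop) _ _) fun v hv => ?_
    have h := heq v hv
    have e1 : ε * (v * (w v * u v))
        = (s * (r - u v) - ε ^ 2 * a * u v + ε ^ 2 * z + ε * e v) * u v := by rw [← h]; ring
    rw [e1]
    have y : ε * e v * (u v - r)
        ≤ σmin / 2 * (u v - r) ^ 2 + ε ^ 2 / (2 * σmin) * (e v) ^ 2 := by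
      have : σmin / 2 * (u v - r) ^ 2 + ε ^ 2 / (2 * σmin) * (e v) ^ 2 - ε * e v * (u v - r)
          = (σmin * (u v - r) - ε * e v) ^ 2 / (2 * σmin) := by field_simp; ring
      have : 0 ≤ (σmin * (u v - r) - ε * e v) ^ 2 / (2 * σmin) := by positivity
      linarith
    have y2 : 0 ≤ ε ^ 2 * a * (u v) ^ 2 := by positivity
    have y3 : 0 ≤ (s - σmin) * (u v - r) ^ 2 := mul_nonneg (by linarith) (sq_nonneg _)
    nlinarith
  rw [intervalIntegral.integral_const_mul] at h1
  refine h1.trans ?_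
  rw [intervalIntegral.integral_add, intervalIntegral.integral_add, intervalIntegral.integral_add,
    intervalIntegral.integral_add]
  · simp only [intervalIntegral.integral_const_mul]
    rw [hq, he0, hum]
    have : 2 * z * r ≤ δ * r ^ 2 + z ^ 2 / δ := by
      have e2 : δ * r ^ 2 + z ^ 2 / δ - 2 * z * r = (δ * r - z) ^ 2 / δ := by field_simp; ring
      have : 0 ≤ (δ * r - z) ^ 2 / δ := by positivity
      linarith
    have := mul_le_mul_of_nonneg_left this (sq_nonneg ε)
    linarith
  all_goals exact Continuous.intervalIntegrable (by fun_prop) _ _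

/-- The derivative of the second moment is controlled by the fluctuation and the source. -/
lemma slice_flux {σmax ε s a r z : ℝ} {u w e : ℝ → ℝ} (hε : 0 < ε) (hε1 : ε ≤ 1)
    (hs0 : 0 ≤ s) (hs : s ≤ σmax) (ha : 0 ≤ a) (has : a ≤ σmax)
    (hu : Continuous u) (he : Continuous e)
    (heq : ∀ v ∈ Icc (-1:ℝ) 1,
      ε * v * w v = s * (r - u v) - ε ^ 2 * a * u v + ε ^ 2 * z + ε * e v) :
    ε ^ 2 * (∫ v in (-1:ℝ)..1, v ^ 2 * w v) ^ 2
      ≤ 16 * σmax ^ 2 * (∫ v in (-1:ℝ)..1, (u v - r) ^ 2)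
        + 4 * ε ^ 2 * ∫ v in (-1:ℝ)..1, (e v) ^ 2 := by
  have h1 : ε * (∫ v in (-1:ℝ)..1, v ^ 2 * w v)
      = -(s + ε ^ 2 * a) * (∫ v in (-1:ℝ)..1, v * (u v - r))
        + ε * ∫ v in (-1:ℝ)..1, v * e v := by
    have h2 : (∫ v in (-1:ℝ)..1, ε * (v ^ 2 * w v))
        = ∫ v in (-1:ℝ)..1, (-(s + ε ^ 2 * a) * (v * (u v - r)) + ε * (v * e v)
          + (ε ^ 2 * z - ε ^ 2 * a * r) * v) := by
      refine intervalIntegral.integral_congr fun v hv => ?_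
      rw [uIcc_of_le (by norm_num)] at hv
      have h := heq v hv
      have : ε * (v ^ 2 * w v) = v * (ε * v * w v) := by ring
      rw [this, h]; ring
    rw [intervalIntegral.integral_const_mul] at h2
    rw [h2, intervalIntegral.integral_add, intervalIntegral.integral_add]
    · have h3 : (∫ v in (-1:ℝ)..1, (ε ^ 2 * z - ε ^ 2 * a * r) * v) = 0 := by
        rw [intervalIntegral.integral_const_mul, integral_id]; ring
      rw [h3]
      simp only [intervalIntegral.integral_const_mul]
      ring
    all_goals exact Continuous.intervalIntegrable (by fun_prop) _ _
  have hA := sq_intervalIntegral_mul_le (g := fun v => u v - r) continuous_id (by fun_prop)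
    fun v hv => sq_le_one_of_mem_Icc hv
  have hB := sq_intervalIntegral_mul_le continuous_id he fun v hv => sq_le_one_of_mem_Icc hv
  simp only [id] at hA hB
  rw [← mul_pow, h1]
  set A := ∫ v in (-1:ℝ)..1, v * (u v - r)
  set B := ∫ v in (-1:ℝ)..1, v * e v
  set Q := ∫ v in (-1:ℝ)..1, (u v - r) ^ 2
  have hc : (s + ε ^ 2 * a) ^ 2 ≤ (2 * σmax) ^ 2 := by
    have : ε ^ 2 * a ≤ a := mul_le_of_le_one_left ha (pow_le_one₀ hε.le hε1)
    exact pow_le_pow_left₀ (by positivity) (by linarith) 2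
  have h3 : (-(s + ε ^ 2 * a) * A + ε * B) ^ 2
      ≤ 2 * ((s + ε ^ 2 * a) ^ 2 * A ^ 2) + 2 * (ε ^ 2 * B ^ 2) := by
    nlinarith [sq_nonneg (-(s + ε ^ 2 * a) * A - ε * B)]
  have h4 : (s + ε ^ 2 * a) ^ 2 * A ^ 2 ≤ (2 * σmax) ^ 2 * (2 * Q) := by gcongr
  have h5 := mul_le_mul_of_nonneg_left hB (sq_nonneg ε)
  linarith

lemma slice_mean {u : ℝ → ℝ} (hu : Continuous u) (r : ℝ) :
    (2/3) * r = (∫ v in (-1:ℝ)..1, v ^ 2 * u v) - ∫ v in (-1:ℝ)..1, v ^ 2 * (u v - r) := by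
  rw [← intervalIntegral.integral_sub]
  · have : ∀ v, v ^ 2 * u v - v ^ 2 * (u v - r) = r * v ^ 2 := fun v => by ring
    simp_rw [this]
    rw [intervalIntegral.integral_const_mul, integral_pow]
    norm_num
    ring
  all_goals exact Continuous.intervalIntegrable (by fun_prop) _ _

lemma intervalIntegral_swap_of_continuous {F : ℝ → ℝ → ℝ} (hF : Continuous (uncurry F))
    (a b c d : ℝ) :
    ∫ x in a..b, ∫ y in c..d, F x y = ∫ y in c..d, ∫ x in a..b, F x y := by
  refine intervalIntegral_intervalIntegral_swap ?_
  exact (hF.continuousOn.integrableOn_compact (isCompact_uIcc.prod isCompact_uIcc)).mono_set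
    (prod_mono uIoc_subset_uIcc uIoc_subset_uIcc)

/-- A `C¹` function on the slab agrees there with a globally defined continuous function having a
globally continuous `x`-derivative. -/
lemma exists_global_extension {f : ℝ → ℝ → ℝ}
    (hf : ContDiffOn ℝ 1 (uncurry f) (Icc (0:ℝ) 1 ×ˢ Icc (-1:ℝ) 1)) :
    ∃ F Fx : ℝ → ℝ → ℝ, Continuous (uncurry F) ∧ Continuous (uncurry Fx) ∧
      (∀ x v, HasDerivAt (fun y => F y v) (Fx x v) x) ∧
      (∀ x ∈ Icc (0:ℝ) 1, ∀ v ∈ Icc (-1:ℝ) 1, F x v = f x v) ∧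
      (∀ x ∈ Ioo (0:ℝ) 1, ∀ v ∈ Icc (-1:ℝ) 1, Fx x v = deriv (fun y => f y v) x) := by
  set S := Icc (0:ℝ) 1 ×ˢ Icc (-1:ℝ) 1 with hS
  have hU : UniqueDiffOn ℝ S :=
    (uniqueDiffOn_Icc zero_lt_one).prod (uniqueDiffOn_Icc (by norm_num))
  set D : ℝ × ℝ → ℝ := fun p => fderivWithin ℝ (uncurry f) S p (1, 0) with hD
  have hDc : ContinuousOn D S :=
    (hf.continuousOn_fderivWithin hU le_rfl).clm_apply continuousOn_const
  set cx : ℝ → ℝ := fun x => max 0 (min 1 x) with hcx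
  set cv : ℝ → ℝ := fun x => max (-1) (min 1 x) with hcv
  have hcxc : Continuous cx := by fun_prop
  have hcvc : Continuous cv := by fun_prop
  have hcxm : ∀ x, cx x ∈ Icc (0:ℝ) 1 := fun x =>
    ⟨le_max_left _ _, max_le (by norm_num) (min_le_left _ _)⟩
  have hcvm : ∀ x, cv x ∈ Icc (-1:ℝ) 1 := fun x =>
    ⟨le_max_left _ _, max_le (by norm_num) (min_le_left _ _)⟩
  have hcxe : ∀ x ∈ Icc (0:ℝ) 1, cx x = x := fun x hx => by
    simp [hcx, min_eq_right hx.2, max_eq_right hx.1]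
  have hcve : ∀ x ∈ Icc (-1:ℝ) 1, cv x = x := fun x hx => by
    simp only [hcv, min_eq_right hx.2, max_eq_right hx.1]
  set Fx : ℝ → ℝ → ℝ := fun x v => D (cx x, cv v) with hFx
  have hFxc : Continuous (uncurry Fx) :=
    hDc.comp_continuous (f := fun p : ℝ × ℝ => (cx p.1, cv p.2)) (by fun_prop)
      fun p => ⟨hcxm _, hcvm _⟩
  have hf0c : Continuous fun v => f 0 (cv v) :=
    hf.continuousOn.comp_continuous (f := fun v : ℝ => ((0:ℝ), cv v)) (by fun_prop)
      fun v => ⟨by simp, hcvm _⟩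
  have hfd : ∀ x ∈ Ioo (0:ℝ) 1, ∀ v ∈ Icc (-1:ℝ) 1, HasDerivAt (fun y => f y v) (Fx x v) x := by
    intro x hx v hv
    have hp : (x, v) ∈ S := ⟨Ioo_subset_Icc_self hx, hv⟩
    have h1 := (hf.differentiableOn one_ne_zero (x, v) hp).hasFDerivWithinAt
    have h2 : HasDerivWithinAt (fun y : ℝ => (y, v)) ((1:ℝ), (0:ℝ)) (Icc 0 1) x :=
      (hasDerivWithinAt_id x _).prodMk (hasDerivWithinAt_const x _ v)
    have h3 := HasFDerivWithinAt.comp_hasDerivWithinAt (t := S) x h1 h2 fun y hy => ⟨hy, hv⟩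
    have h4 := h3.hasDerivAt (Icc_mem_nhds hx.1 hx.2)
    have : Fx x v = fderivWithin ℝ (uncurry f) S (x, v) (1, 0) := by
      simp only [hFx, hD, hcxe x (Ioo_subset_Icc_self hx), hcve v hv]
    rw [this]
    exact h4
  refine ⟨fun x v => f 0 (cv v) + ∫ t in (0:ℝ)..x, Fx t v, Fx, ?_, hFxc, ?_, ?_, ?_⟩
  · refine Continuous.add (hf0c.comp continuous_snd) ?_
    exact intervalIntegral.continuous_parametric_intervalIntegral_of_continuous
      (f := fun (p : ℝ × ℝ) t => Fx t p.2) (s := Prod.fst)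
      (hFxc.comp (by fun_prop : Continuous fun q : (ℝ × ℝ) × ℝ => (q.2, q.1.2))) continuous_fst
  · intro x v
    have hc : Continuous fun t => Fx t v :=
      hFxc.comp (by fun_prop : Continuous fun t : ℝ => (t, v))
    exact (intervalIntegral.integral_hasDerivAt_right (hc.intervalIntegrable _ _)
      (hc.stronglyMeasurableAtFilter _ _) hc.continuousAt).const_add _
  · intro x hx v hv
    have hc : Continuous fun t => Fx t v :=
      hFxc.comp (by fun_prop : Continuous fun t : ℝ => (t, v))
    have hcf : ContinuousOn (fun y => f y v) (Icc 0 x) :=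
      hf.continuousOn.comp (f := fun y : ℝ => (y, v)) (by fun_prop)
        fun y hy => ⟨⟨hy.1, hy.2.trans hx.2⟩, hv⟩
    have := intervalIntegral.integral_eq_sub_of_hasDerivAt_of_le hx.1 hcf
      (fun y hy => hfd y ⟨hy.1, hy.2.trans_le hx.2⟩ v hv) (hc.intervalIntegrable _ _)
    simp only [this, hcve v hv]
    ring
  · intro x hx v hv
    exact (hfd x hx v hv).deriv.symm

lemma energy_estimate {σmin σmax ε δ I : ℝ} (hσmin : 0 < σmin) (hδ : 0 < δ)
    (hε : 0 < ε) {σs σa z ρ : ℝ → ℝ} {h hx e : ℝ → ℝ → ℝ}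
    (hs : ∀ x ∈ Icc (0:ℝ) 1, σmin ≤ σs x ∧ σs x ≤ σmax)
    (ha : ∀ x ∈ Icc (0:ℝ) 1, 0 ≤ σa x ∧ σa x ≤ σmax)
    (hz : Continuous z) (hh : Continuous (uncurry h)) (hhx : Continuous (uncurry hx))
    (he : Continuous (uncurry e)) (hd : ∀ x v, HasDerivAt (fun y => h y v) (hx x v) x)
    (hρ : ρ = vavg h) (he0 : ∀ x ∈ Icc (0:ℝ) 1, (∫ v in (-1:ℝ)..1, e x v) = 0)
    (heq : ∀ x ∈ Ioo (0:ℝ) 1, ∀ v ∈ Icc (-1:ℝ) 1,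
      ε * v * hx x v = σs x * (ρ x - h x v) - ε ^ 2 * σa x * h x v + ε ^ 2 * z x + ε * e x v)
    (hI : (∫ v in (0:ℝ)..1, (h 0 v) ^ 2) + (∫ v in (-1:ℝ)..0, (h 1 v) ^ 2) ≤ I) :
    σmin * (∫ x in (0:ℝ)..1, ∫ v in (-1:ℝ)..1, (h x v - ρ x) ^ 2)
        + ε * ∫ v in (-1:ℝ)..1, |v| * (h 0 v) ^ 2
      ≤ 2 * ε ^ 2 * (δ * (∫ x in (0:ℝ)..1, (ρ x) ^ 2) + (∫ x in (0:ℝ)..1, (z x) ^ 2) / δ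
        + (∫ x in (0:ℝ)..1, ∫ v in (-1:ℝ)..1, (e x v) ^ 2) / (2 * σmin)) + 2 * ε * I := by
  have hρc : Continuous ρ := by rw [hρ]; unfold vavg; fun_prop
  have hsl : ∀ {g : ℝ → ℝ → ℝ}, Continuous (uncurry g) → ∀ x, Continuous (g x) :=
    fun hg x => hg.comp (by fun_prop : Continuous fun v : ℝ => (x, v))
  have hh0 := hsl hh 0
  have hh1 := hsl hh 1
  have h1 : (∫ x in (0:ℝ)..1, ε * (∫ v in (-1:ℝ)..1, v * (hx x v * h x v)))
      ≤ ∫ x in (0:ℝ)..1, (-(σmin / 2) * (∫ v in (-1:ℝ)..1, (h x v - ρ x) ^ 2)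
        + ε ^ 2 * (δ * (ρ x) ^ 2 + (z x) ^ 2 / δ)
        + ε ^ 2 / (2 * σmin) * ∫ v in (-1:ℝ)..1, (e x v) ^ 2) := by
    refine intervalIntegral.integral_mono_on_of_le_Ioo (by norm_num)
      (Continuous.intervalIntegrable (by fun_prop) _ _)
      (Continuous.intervalIntegrable (by fun_prop) _ _) fun x hx' => ?_
    have hx1 := Ioo_subset_Icc_self hx'
    exact slice_energy hσmin (hs x hx1).1 (ha x hx1).1 hδ (hsl hh x) (hsl hhx x) (hsl he x)
      (by rw [hρ]; rfl) (he0 x hx1) (heq x hx')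
  have h2 : (∫ x in (0:ℝ)..1, (-(σmin / 2) * (∫ v in (-1:ℝ)..1, (h x v - ρ x) ^ 2)
        + ε ^ 2 * (δ * (ρ x) ^ 2 + (z x) ^ 2 / δ)
        + ε ^ 2 / (2 * σmin) * ∫ v in (-1:ℝ)..1, (e x v) ^ 2))
      = -(σmin / 2) * (∫ x in (0:ℝ)..1, ∫ v in (-1:ℝ)..1, (h x v - ρ x) ^ 2)
        + ε ^ 2 * (δ * (∫ x in (0:ℝ)..1, (ρ x) ^ 2) + (∫ x in (0:ℝ)..1, (z x) ^ 2) / δ)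
        + ε ^ 2 / (2 * σmin) * ∫ x in (0:ℝ)..1, ∫ v in (-1:ℝ)..1, (e x v) ^ 2 := by
    rw [intervalIntegral.integral_add, intervalIntegral.integral_add,
      intervalIntegral.integral_const_mul, intervalIntegral.integral_const_mul,
      intervalIntegral.integral_const_mul, intervalIntegral.integral_add,
      intervalIntegral.integral_const_mul, intervalIntegral.integral_div]
    all_goals exact Continuous.intervalIntegrable (by fun_prop) _ _
  have h3 : (∫ x in (0:ℝ)..1, ∫ v in (-1:ℝ)..1, v * (hx x v * h x v))
      = (∫ v in (-1:ℝ)..1, v * (h 1 v) ^ 2) / 2 - (∫ v in (-1:ℝ)..1, v * (h 0 v) ^ 2) / 2 := by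
    rw [intervalIntegral_swap_of_continuous (F := fun x v => v * (hx x v * h x v)) (by fun_prop),
      ← sub_div, ← intervalIntegral.integral_sub, ← intervalIntegral.integral_div]
    · refine intervalIntegral.integral_congr fun v _ => ?_
      have hF : ∀ x ∈ uIcc (0:ℝ) 1,
          HasDerivAt (fun x => v * (h x v) ^ 2 / 2) (v * (hx x v * h x v)) x := by
        intro x _
        refine ((((hd x v).fun_pow 2).const_mul v).div_const 2).congr_deriv ?_
        push_cast; ring
      rw [intervalIntegral.integral_eq_sub_of_hasDerivAt hF
        (Continuous.intervalIntegrable (by fun_prop) _ _)]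
      ring
    all_goals exact Continuous.intervalIntegrable (by fun_prop) _ _
  have split : ∀ {g : ℝ → ℝ}, Continuous g → (∫ v in (-1:ℝ)..1, g v)
      = (∫ v in (-1:ℝ)..0, g v) + ∫ v in (0:ℝ)..1, g v := fun hg =>
    (intervalIntegral.integral_add_adjacent_intervals (hg.intervalIntegrable _ _)
      (hg.intervalIntegrable _ _)).symm
  have o1 : -(∫ v in (-1:ℝ)..0, (h 1 v) ^ 2) ≤ ∫ v in (-1:ℝ)..1, v * (h 1 v) ^ 2 := by
    rw [split (by fun_prop)]
    have a1 : 0 ≤ ∫ v in (0:ℝ)..1, v * (h 1 v) ^ 2 :=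
      intervalIntegral.integral_nonneg (by norm_num) fun v hv => mul_nonneg hv.1 (sq_nonneg _)
    have a2 : (∫ v in (-1:ℝ)..0, -((h 1 v) ^ 2)) ≤ ∫ v in (-1:ℝ)..0, v * (h 1 v) ^ 2 := by
      refine intervalIntegral.integral_mono_on (by norm_num)
        (Continuous.intervalIntegrable (by fun_prop) _ _)
        (Continuous.intervalIntegrable (by fun_prop) _ _) fun v hv => ?_
      nlinarith [hv.1, sq_nonneg (h 1 v)]
    rw [intervalIntegral.integral_neg] at a2
    linarith
  have o0 : (∫ v in (-1:ℝ)..1, v * (h 0 v) ^ 2) + (∫ v in (-1:ℝ)..1, |v| * (h 0 v) ^ 2)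
      ≤ 2 * ∫ v in (0:ℝ)..1, (h 0 v) ^ 2 := by
    rw [← intervalIntegral.integral_add (Continuous.intervalIntegrable (by fun_prop) _ _)
        (Continuous.intervalIntegrable (by fun_prop) _ _), split (by fun_prop)]
    have a1 : (∫ v in (0:ℝ)..1, (v * (h 0 v) ^ 2 + |v| * (h 0 v) ^ 2))
        ≤ ∫ v in (0:ℝ)..1, 2 * (h 0 v) ^ 2 := by
      refine intervalIntegral.integral_mono_on (by norm_num)
        (Continuous.intervalIntegrable (by fun_prop) _ _)
        (Continuous.intervalIntegrable (by fun_prop) _ _) fun v hv => ?_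
      rw [abs_of_nonneg hv.1]
      nlinarith [hv.2, sq_nonneg (h 0 v)]
    have a2 : (∫ v in (-1:ℝ)..0, (v * (h 0 v) ^ 2 + |v| * (h 0 v) ^ 2))
        ≤ ∫ v in (-1:ℝ)..0, (0:ℝ) := by
      refine intervalIntegral.integral_mono_on (by norm_num)
        (Continuous.intervalIntegrable (by fun_prop) _ _)
        (Continuous.intervalIntegrable (by fun_prop) _ _) fun v hv => ?_
      rw [abs_of_nonpos hv.2]
      linarith
    rw [intervalIntegral.integral_const_mul] at a1
    simp only [intervalIntegral.integral_zero] at a2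
    linarith
  have p0 : 0 ≤ ∫ v in (-1:ℝ)..0, (h 1 v) ^ 2 :=
    intervalIntegral.integral_nonneg (by norm_num) fun v _ => sq_nonneg _
  rw [h2, intervalIntegral.integral_const_mul, h3] at h1
  have h4 : (∫ v in (-1:ℝ)..1, |v| * (h 0 v) ^ 2) / 2 - I
      ≤ (∫ v in (-1:ℝ)..1, v * (h 1 v) ^ 2) / 2 - (∫ v in (-1:ℝ)..1, v * (h 0 v) ^ 2) / 2 := by
    linarith
  have h5 := mul_le_mul_of_nonneg_left h4 hε.le
  have e6 : ∀ H : ℝ, ε ^ 2 / (2 * σmin) * H = ε ^ 2 * (H / (2 * σmin)) := fun H => by ring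
  rw [e6] at h1
  linarith

lemma mean_estimate {σmin σmax ε : ℝ} (hσmin : 0 < σmin)
    (hε : 0 < ε) (hε1 : ε ≤ 1) {σs σa z ρ : ℝ → ℝ} {h hx e : ℝ → ℝ → ℝ}
    (hs : ∀ x ∈ Icc (0:ℝ) 1, σmin ≤ σs x ∧ σs x ≤ σmax)
    (ha : ∀ x ∈ Icc (0:ℝ) 1, 0 ≤ σa x ∧ σa x ≤ σmax)
    (hh : Continuous (uncurry h)) (hhx : Continuous (uncurry hx))
    (he : Continuous (uncurry e)) (hd : ∀ x v, HasDerivAt (fun y => h y v) (hx x v) x)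
    (hρ : ρ = vavg h)
    (heq : ∀ x ∈ Ioo (0:ℝ) 1, ∀ v ∈ Icc (-1:ℝ) 1,
      ε * v * hx x v = σs x * (ρ x - h x v) - ε ^ 2 * σa x * h x v + ε ^ 2 * z x + ε * e x v) :
    ε ^ 2 * (∫ x in (0:ℝ)..1, (ρ x) ^ 2)
      ≤ 7 * ((16 * σmax ^ 2 + 2) * (∫ x in (0:ℝ)..1, ∫ v in (-1:ℝ)..1, (h x v - ρ x) ^ 2)
        + 4 * ε ^ 2 * (∫ x in (0:ℝ)..1, ∫ v in (-1:ℝ)..1, (e x v) ^ 2)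
        + 2 * ε ^ 2 * ∫ v in (-1:ℝ)..1, |v| * (h 0 v) ^ 2) := by
  have hρc : Continuous ρ := by rw [hρ]; unfold vavg; fun_prop
  have hsl : ∀ {g : ℝ → ℝ → ℝ}, Continuous (uncurry g) → ∀ x, Continuous (g x) :=
    fun hg x => hg.comp (by fun_prop : Continuous fun v : ℝ => (x, v))
  have hh0 := hsl hh 0
  set Q := ∫ x in (0:ℝ)..1, ∫ v in (-1:ℝ)..1, (h x v - ρ x) ^ 2 with hQ
  set E := ∫ x in (0:ℝ)..1, ∫ v in (-1:ℝ)..1, (e x v) ^ 2 with hE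
  set B := ∫ v in (-1:ℝ)..1, |v| * (h 0 v) ^ 2 with hB
  set K : ℝ → ℝ := fun x => ∫ v in (-1:ℝ)..1, v ^ 2 * h x v with hK
  set J : ℝ → ℝ := fun x => ∫ v in (-1:ℝ)..1, v ^ 2 * hx x v with hJ
  have hJc : Continuous J := by fun_prop
  have hJint : ε ^ 2 * (∫ x in (0:ℝ)..1, (J x) ^ 2) ≤ 16 * σmax ^ 2 * Q + 4 * ε ^ 2 * E := by
    rw [hQ, hE, ← intervalIntegral.integral_const_mul, ← intervalIntegral.integral_const_mul,
      ← intervalIntegral.integral_const_mul, ← intervalIntegral.integral_add]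
    · refine intervalIntegral.integral_mono_on_of_le_Ioo (by norm_num)
        (Continuous.intervalIntegrable (by fun_prop) _ _)
        (Continuous.intervalIntegrable (by fun_prop) _ _) fun x hx' => ?_
      have hx1 := Ioo_subset_Icc_self hx'
      exact slice_flux hε hε1 (hσmin.le.trans (hs x hx1).1) (hs x hx1).2 (ha x hx1).1
        (ha x hx1).2 (hsl hh x) (hsl he x) (heq x hx')
    all_goals exact Continuous.intervalIntegrable (by fun_prop) _ _
  have hKx : ∀ x ∈ Icc (0:ℝ) 1, (K x - K 0) ^ 2 ≤ ∫ x in (0:ℝ)..1, (J x) ^ 2 := by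
    intro x hx1
    have h3 : K x - K 0 = ∫ t in (0:ℝ)..x, J t := by
      simp only [hK, hJ]
      rw [intervalIntegral_swap_of_continuous (F := fun x v => v ^ 2 * hx x v) (by fun_prop),
        ← intervalIntegral.integral_sub]
      · refine intervalIntegral.integral_congr fun v _ => ?_
        have hF : ∀ y ∈ uIcc (0:ℝ) x,
            HasDerivAt (fun y => v ^ 2 * h y v) (v ^ 2 * hx y v) y := fun y _ =>
          (hd y v).const_mul _
        rw [intervalIntegral.integral_eq_sub_of_hasDerivAt hF
          (Continuous.intervalIntegrable (by fun_prop) _ _)]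
      all_goals exact Continuous.intervalIntegrable (by fun_prop) _ _
    have nn : 0 ≤ ∫ t in (0:ℝ)..x, (J t) ^ 2 :=
      intervalIntegral.integral_nonneg hx1.1 fun t _ => sq_nonneg _
    calc (K x - K 0) ^ 2 ≤ (x - 0) * ∫ t in (0:ℝ)..x, (J t) ^ 2 := by
          rw [h3]; exact sq_intervalIntegral_le hJc hx1.1
      _ ≤ ∫ t in (0:ℝ)..x, (J t) ^ 2 := mul_le_of_le_one_left nn (by linarith [hx1.2])
      _ ≤ ∫ x in (0:ℝ)..1, (J x) ^ 2 :=
          intervalIntegral.integral_mono_interval le_rfl hx1.1 hx1.2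
            (Filter.Eventually.of_forall fun t => sq_nonneg _)
            (Continuous.intervalIntegrable (by fun_prop) _ _)
  have hK0 : (K 0) ^ 2 ≤ 2 * B := by
    have := sq_intervalIntegral_le (g := fun v => v ^ 2 * h 0 v) (by fun_prop)
      (by norm_num : (-1:ℝ) ≤ 1)
    refine this.trans ?_
    rw [show (1:ℝ) - -1 = 2 by norm_num]
    gcongr
    refine intervalIntegral.integral_mono_on (by norm_num)
      (Continuous.intervalIntegrable (by fun_prop) _ _)
      (Continuous.intervalIntegrable (by fun_prop) _ _) fun v hv => ?_
    have h1 : |v| ≤ 1 := abs_le.2 hv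
    rw [mul_pow]
    gcongr
    rw [← sq_abs v, ← pow_mul]
    exact pow_le_of_le_one (abs_nonneg v) h1 (by norm_num)
  have hpt : ∀ x ∈ Icc (0:ℝ) 1, (ρ x) ^ 2 ≤ 7 * ((∫ x in (0:ℝ)..1, (J x) ^ 2) + 2 * B)
      + 14 * ∫ v in (-1:ℝ)..1, (h x v - ρ x) ^ 2 := by
    intro x hx1
    have m := slice_mean (hsl hh x) (ρ x)
    have c := sq_intervalIntegral_mul_le (w := fun v => v ^ 2) (g := fun v => h x v - ρ x)
      (by fun_prop) ((hsl hh x).sub continuous_const)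
      fun v hv => pow_le_one₀ (sq_nonneg v) (sq_le_one_of_mem_Icc hv)
    have k := hKx x hx1
    change (2/3) * ρ x = K x - _ at m
    set M := ∫ v in (-1:ℝ)..1, v ^ 2 * (h x v - ρ x)
    have : (ρ x) ^ 2 ≤ 7 * ((K x - K 0) ^ 2 + (K 0) ^ 2 + M ^ 2) := by
      have e1 : ρ x = (3/2) * ((K x - K 0) + K 0 - M) := by linarith
      rw [e1]
      nlinarith [sq_nonneg ((K x - K 0) - K 0), sq_nonneg ((K x - K 0) + M),
        sq_nonneg (K 0 + M), sq_nonneg (K x - K 0), sq_nonneg (K 0), sq_nonneg M]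
    linarith
  have hR : (∫ x in (0:ℝ)..1, (ρ x) ^ 2)
      ≤ 7 * ((∫ x in (0:ℝ)..1, (J x) ^ 2) + 2 * B) + 14 * Q := by
    have := intervalIntegral.integral_mono_on (μ := volume) (zero_le_one (α := ℝ))
      (Continuous.intervalIntegrable (by fun_prop) _ _)
      (Continuous.intervalIntegrable (by fun_prop) _ _) hpt
    rw [intervalIntegral.integral_add (by simp)
      (Continuous.intervalIntegrable (by fun_prop) _ _),
      intervalIntegral.integral_const_mul 14] at this
    simpa using this
  have hQ0 : 0 ≤ Q := intervalIntegral.integral_nonneg (by norm_num) fun x _ =>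
    intervalIntegral.integral_nonneg (by norm_num) fun v _ => sq_nonneg _
  have hε2 : ε ^ 2 ≤ 1 := pow_le_one₀ hε.le hε1
  have h1 := mul_le_mul_of_nonneg_left hR (sq_nonneg ε)
  have h2 := mul_le_mul_of_nonneg_right hε2 hQ0
  linarith

/-- Stability for solutions whose inflow data has size `O(ε)`. -/
lemma exists_stability_const {σmin σmax : ℝ} (hσmin : 0 < σmin) :
    ∃ C > 0, ∀ ε ∈ Ioc (0:ℝ) 1, ∀ (σs σa z ρ : ℝ → ℝ) (h hx e : ℝ → ℝ → ℝ) (Z : ℝ),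
      (∀ x ∈ Icc (0:ℝ) 1, σmin ≤ σs x ∧ σs x ≤ σmax) →
      (∀ x ∈ Icc (0:ℝ) 1, 0 ≤ σa x ∧ σa x ≤ σmax) →
      Continuous z → Continuous (uncurry h) → Continuous (uncurry hx) → Continuous (uncurry e) →
      (∀ x v, HasDerivAt (fun y => h y v) (hx x v) x) →
      ρ = vavg h → (∀ x ∈ Icc (0:ℝ) 1, (∫ v in (-1:ℝ)..1, e x v) = 0) →
      (∀ x ∈ Ioo (0:ℝ) 1, ∀ v ∈ Icc (-1:ℝ) 1,
        ε * v * hx x v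
          = σs x * (ρ x - h x v) - ε ^ 2 * σa x * h x v + ε ^ 2 * z x + ε * e x v) →
      (∫ v in (0:ℝ)..1, (h 0 v) ^ 2) + (∫ v in (-1:ℝ)..0, (h 1 v) ^ 2) = ε ^ 2 * Z →
      (∫ x in (0:ℝ)..1, ∫ v in (-1:ℝ)..1, (h x v) ^ 2)
        ≤ C * ((∫ x in (0:ℝ)..1, (z x) ^ 2)
          + (∫ x in (0:ℝ)..1, ∫ v in (-1:ℝ)..1, (e x v) ^ 2) + ε * Z) := by
  set A : ℝ := 7 * ((16 * σmax ^ 2 + 2) / σmin + 2) with hA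
  have hA0 : 0 < A := by positivity
  set k : ℝ := 8 * A + 1 / σmin + 2 with hk
  have hk0 : 0 < k := by positivity
  -- the bound for `∫ ρ ^ 2`
  set P : ℝ := 2 * A * k + 56 with hP
  have hP0 : 0 < P := by positivity
  refine ⟨2 * P + (P / (2 * A) + k) / σmin, by positivity, ?_⟩
  rintro ε ⟨hε, hε1⟩ σs σa z ρ h hx e Z hs ha hz hh hhx he hd hρ he0 heq hI
  have hρc : Continuous ρ := by rw [hρ]; unfold vavg; fun_prop
  have E1 := energy_estimate (δ := 1 / (4 * A)) hσmin (by positivity) hε hs ha hz hh hhx he hd hρ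
    he0 heq hI.le
  have E2 := mean_estimate hσmin hε hε1 hs ha hh hhx he hd hρ heq
  have hN : (∫ x in (0:ℝ)..1, ∫ v in (-1:ℝ)..1, (h x v) ^ 2)
      = 2 * (∫ x in (0:ℝ)..1, (ρ x) ^ 2)
        + ∫ x in (0:ℝ)..1, ∫ v in (-1:ℝ)..1, (h x v - ρ x) ^ 2 := by
    rw [← intervalIntegral.integral_const_mul, ← intervalIntegral.integral_add
      (Continuous.intervalIntegrable (by fun_prop) _ _)
      (Continuous.intervalIntegrable (by fun_prop) _ _)]
    refine intervalIntegral.integral_congr fun x _ => ?_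
    have hc : Continuous (h x) := hh.comp (by fun_prop : Continuous fun v : ℝ => (x, v))
    have hm := integral_sub_mean hc (show ρ x = _ by rw [hρ]; rfl)
    have : ∀ v, (h x v) ^ 2
        = (h x v - ρ x) ^ 2 + 2 * ρ x * (h x v - ρ x) + (ρ x) ^ 2 := fun v => by ring
    simp only [this]
    rw [intervalIntegral.integral_add, intervalIntegral.integral_add,
      intervalIntegral.integral_const_mul, hm, intervalIntegral.integral_const, smul_eq_mul]
    · ring
    all_goals exact Continuous.intervalIntegrable (by fun_prop) _ _
  have hZ0 : 0 ≤ ε ^ 2 * Z := hI ▸ add_nonneg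
    (intervalIntegral.integral_nonneg (by norm_num) fun v _ => sq_nonneg _)
    (intervalIntegral.integral_nonneg (by norm_num) fun v _ => sq_nonneg _)
  have hZ : 0 ≤ Z := nonneg_of_mul_nonneg_right hZ0 (by positivity)
  have hB0 : 0 ≤ ∫ v in (-1:ℝ)..1, |v| * (h 0 v) ^ 2 :=
    intervalIntegral.integral_nonneg (by norm_num) fun v _ => by positivity
  have hX0 : 0 ≤ ∫ x in (0:ℝ)..1, (z x) ^ 2 :=
    intervalIntegral.integral_nonneg (by norm_num) fun v _ => sq_nonneg _
  have hR0 : 0 ≤ ∫ x in (0:ℝ)..1, (ρ x) ^ 2 :=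
    intervalIntegral.integral_nonneg (by norm_num) fun v _ => sq_nonneg _
  have hE0 : 0 ≤ ∫ x in (0:ℝ)..1, ∫ v in (-1:ℝ)..1, (e x v) ^ 2 :=
    intervalIntegral.integral_nonneg (by norm_num) fun v _ =>
      intervalIntegral.integral_nonneg (by norm_num) fun v _ => sq_nonneg _
  have hQ0 : 0 ≤ ∫ x in (0:ℝ)..1, ∫ v in (-1:ℝ)..1, (h x v - ρ x) ^ 2 :=
    intervalIntegral.integral_nonneg (by norm_num) fun v _ =>
      intervalIntegral.integral_nonneg (by norm_num) fun v _ => sq_nonneg _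
  rw [hN]
  generalize (∫ x in (0:ℝ)..1, ∫ v in (-1:ℝ)..1, (h x v - ρ x) ^ 2) = Q at *
  generalize (∫ x in (0:ℝ)..1, ∫ v in (-1:ℝ)..1, (e x v) ^ 2) = E at *
  generalize (∫ v in (-1:ℝ)..1, |v| * (h 0 v) ^ 2) = B at *
  generalize (∫ x in (0:ℝ)..1, (z x) ^ 2) = X at *
  generalize (∫ x in (0:ℝ)..1, (ρ x) ^ 2) = R at *
  set S := X + E + ε * Z with hS
  have hεZ : 0 ≤ ε * Z := by positivity
  have hS0 : 0 ≤ S := by positivity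
  set T := R / (2 * A) + k * S with hT
  have hT0 : 0 ≤ T := by positivity
  have E3 : σmin * Q + ε * B ≤ ε ^ 2 * T := by
    refine E1.trans ?_
    have t1 : T - 2 * (1 / (4 * A) * R + X / (1 / (4 * A)) + E / (2 * σmin)) - 2 * (ε * Z)
        = (1 / σmin + 2) * X + (8 * A + 2) * E + (8 * A + 1 / σmin) * (ε * Z) := by
      rw [hT, hk, hS]; field_simp; ring
    have t2 : 0 ≤ (1 / σmin + 2) * X + (8 * A + 2) * E + (8 * A + 1 / σmin) * (ε * Z) := by
      positivity
    have t3 := mul_nonneg (sq_nonneg ε) (t1 ▸ t2)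
    linarith
  have hQ : Q ≤ ε ^ 2 * (T / σmin) := by
    rw [← mul_div_assoc, le_div_iff₀ hσmin]
    nlinarith [mul_nonneg hε.le hB0]
  have hB : B ≤ T := by
    have : ε * B ≤ ε * (ε * T) := by nlinarith [mul_nonneg hσmin.le hQ0]
    have := le_of_mul_le_mul_left this hε
    nlinarith
  have hε2 : 0 < ε ^ 2 := by positivity
  have hR : R ≤ A * T + 28 * E := by
    refine le_of_mul_le_mul_left ?_ hε2
    refine E2.trans ?_
    have q1 : (16 * σmax ^ 2 + 2) * Q ≤ (16 * σmax ^ 2 + 2) * (ε ^ 2 * (T / σmin)) := by gcongr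
    have q2 := mul_le_mul_of_nonneg_left hB hε2.le
    have q3 : ε ^ 2 * (A * T + 28 * E)
        = 7 * ((16 * σmax ^ 2 + 2) * (ε ^ 2 * (T / σmin)) + 4 * ε ^ 2 * E
          + 2 * (ε ^ 2 * T)) := by rw [hA]; ring
    rw [q3]
    linarith
  have hES : E ≤ S := by rw [hS]; linarith
  have hRP : R ≤ P * S := by
    have : A * T = R / 2 + A * k * S := by rw [hT]; field_simp
    rw [hP]
    linarith
  have hQT : Q ≤ T / σmin := hQ.trans
    (mul_le_of_le_one_left (by positivity) (pow_le_one₀ hε.le hε1))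
  have hTS : T ≤ (P / (2 * A) + k) * S := by
    have : R / (2 * A) ≤ P * S / (2 * A) := by gcongr
    have e : (P / (2 * A) + k) * S = P * S / (2 * A) + k * S := by ring
    rw [e, hT]
    linarith
  have hTS' : T / σmin ≤ (P / (2 * A) + k) * S / σmin := by gcongr
  have e : (2 * P + (P / (2 * A) + k) / σmin) * S
      = 2 * (P * S) + (P / (2 * A) + k) * S / σmin := by ring
  rw [e]
  linarith

/-- A continuous function on the slab extends to a continuous function on the plane. -/
lemma exists_continuous_extension {f : ℝ → ℝ → ℝ}
    (hf : ContinuousOn (uncurry f) (Icc (0:ℝ) 1 ×ˢ Icc (-1:ℝ) 1)) :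
    ∃ F : ℝ → ℝ → ℝ, Continuous (uncurry F) ∧
      ∀ x ∈ Icc (0:ℝ) 1, ∀ v ∈ Icc (-1:ℝ) 1, F x v = f x v := by
  refine ⟨fun x v => f (max 0 (min 1 x)) (max (-1) (min 1 v)), ?_, fun x hx v hv => ?_⟩
  · refine hf.comp_continuous
      (f := fun p : ℝ × ℝ => (max 0 (min 1 p.1), max (-1) (min 1 p.2))) (by fun_prop) fun p => ?_
    exact ⟨⟨le_max_left _ _, max_le (by norm_num) (min_le_left _ _)⟩,
      ⟨le_max_left _ _, max_le (by norm_num) (min_le_left _ _)⟩⟩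
  · simp only [min_eq_right hx.2, max_eq_right hx.1, min_eq_right hv.2, max_eq_right hv.1]

lemma exists_continuous_extension_Icc {f : ℝ → ℝ} (hf : ContinuousOn f (Icc (0:ℝ) 1)) :
    ∃ F : ℝ → ℝ, Continuous F ∧ ∀ x ∈ Icc (0:ℝ) 1, F x = f x := by
  refine ⟨fun x => f (max 0 (min 1 x)), hf.comp_continuous (by fun_prop) fun x =>
    ⟨le_max_left _ _, max_le (by norm_num) (min_le_left _ _)⟩, fun x hx => ?_⟩
  simp only [min_eq_right hx.2, max_eq_right hx.1]

lemma slab_integral_congr {f g : ℝ → ℝ → ℝ}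
    (h : ∀ x ∈ Icc (0:ℝ) 1, ∀ v ∈ Icc (-1:ℝ) 1, f x v = g x v) :
    (∫ x in (0:ℝ)..1, ∫ v in (-1:ℝ)..1, (f x v) ^ 2)
      = ∫ x in (0:ℝ)..1, ∫ v in (-1:ℝ)..1, (g x v) ^ 2 := by
  refine intervalIntegral.integral_congr fun x hx => intervalIntegral.integral_congr fun v hv => ?_
  rw [uIcc_of_le (by norm_num)] at hx hv
  simp only [h x hx v hv]

/-- Poincaré inequality with an endpoint value. -/
lemma integral_sq_le_endpoint {Z Z' : ℝ → ℝ} (hZ' : Continuous Z')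
    (hd : ∀ x, HasDerivAt Z (Z' x) x) :
    (∫ x in (0:ℝ)..1, (Z x) ^ 2) ≤ 2 * (Z 0) ^ 2 + 2 * ∫ x in (0:ℝ)..1, (Z' x) ^ 2 := by
  have hZ : Continuous Z := continuous_iff_continuousAt.2 fun x => (hd x).continuousAt
  have hpt : ∀ x ∈ Icc (0:ℝ) 1,
      (Z x) ^ 2 ≤ 2 * (Z 0) ^ 2 + 2 * ∫ x in (0:ℝ)..1, (Z' x) ^ 2 := by
    intro x hx
    have h1 : (∫ t in (0:ℝ)..x, Z' t) = Z x - Z 0 :=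
      intervalIntegral.integral_eq_sub_of_hasDerivAt (fun y _ => hd y)
        (hZ'.intervalIntegrable _ _)
    have nn : 0 ≤ ∫ t in (0:ℝ)..x, (Z' t) ^ 2 :=
      intervalIntegral.integral_nonneg hx.1 fun t _ => sq_nonneg _
    have h2 : (Z x - Z 0) ^ 2 ≤ ∫ x in (0:ℝ)..1, (Z' x) ^ 2 :=
      calc (Z x - Z 0) ^ 2 ≤ (x - 0) * ∫ t in (0:ℝ)..x, (Z' t) ^ 2 := by
            rw [← h1]; exact sq_intervalIntegral_le hZ' hx.1
        _ ≤ ∫ t in (0:ℝ)..x, (Z' t) ^ 2 := mul_le_of_le_one_left nn (by linarith [hx.2])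
        _ ≤ ∫ x in (0:ℝ)..1, (Z' x) ^ 2 :=
            intervalIntegral.integral_mono_interval le_rfl hx.1 hx.2
              (Filter.Eventually.of_forall fun t => sq_nonneg _)
              (Continuous.intervalIntegrable (by fun_prop) _ _)
    nlinarith [sq_nonneg (Z x - 2 * Z 0)]
  have := intervalIntegral.integral_mono_on (μ := volume) (zero_le_one (α := ℝ))
    (Continuous.intervalIntegrable (by fun_prop) _ _) (by simp) hpt
  simpa using this

/-- Stability lemma, improved estimate for split boundary data
`ζ = ζ₁(x) + ε ζ₂(x,v)` (1D, isotropic scattering): the constant `C` depends only on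
`σ_min, σ_max` and in particular stays bounded as `ε ↓ 0`. -/
theorem stability_improved_estimate (σmin σmax : ℝ) (hσmin : 0 < σmin) (hσ : σmin ≤ σmax) :
    ∃ C > 0, ∀ ε ∈ Ioc (0:ℝ) 1, ∀ σs σa ξ ζ₁ : ℝ → ℝ, ∀ η ζ₂ f : ℝ → ℝ → ℝ,
      (∀ x ∈ Icc (0:ℝ) 1, σmin ≤ σs x ∧ σs x ≤ σmax) →
      (∀ x ∈ Icc (0:ℝ) 1, 0 ≤ σa x ∧ σa x ≤ σmax) →
      ContinuousOn σs (Icc 0 1) → ContinuousOn σa (Icc 0 1) →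
      ContinuousOn ξ (Icc 0 1) →
      ContinuousOn (uncurry η) (Icc (0:ℝ) 1 ×ˢ Icc (-1:ℝ) 1) →
      (∀ x ∈ Icc (0:ℝ) 1, vavg η x = 0) →
      ContDiffOn ℝ 1 ζ₁ (Icc 0 1) →
      C1Omega f →
      (∀ x ∈ Icc (0:ℝ) 1, ∀ v ∈ Icc (-1:ℝ) 1,
        ε * v * deriv (fun y => f y v) x
          = σs x * (vavg f x - f x v) - ε ^ 2 * σa x * f x v
            + ε ^ 2 * ξ x + ε * η x v) →
      (∀ v ∈ Ioc (0:ℝ) 1, f 0 v = ζ₁ 0 + ε * ζ₂ 0 v) →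
      (∀ v ∈ Ico (-1:ℝ) 0, f 1 v = ζ₁ 1 + ε * ζ₂ 1 v) →
      (∫ x in (0:ℝ)..1, ∫ v in (-1:ℝ)..1, (f x v) ^ 2)
        ≤ C * ((∫ x in (0:ℝ)..1, (ξ x) ^ 2)
            + (∫ x in (0:ℝ)..1, ∫ v in (-1:ℝ)..1, (η x v) ^ 2)
            + (ζ₁ 0) ^ 2 + (ζ₁ 1) ^ 2 + (∫ x in (0:ℝ)..1, (deriv ζ₁ x) ^ 2)
            + ε * ((∫ v in (0:ℝ)..1, (ζ₂ 0 v) ^ 2)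
                + ∫ v in (-1:ℝ)..0, (ζ₂ 1 v) ^ 2)) := by
  obtain ⟨C, hC, hmain⟩ := exists_stability_const (σmax := σmax) hσmin
  refine ⟨2 * C * (2 + 4 * σmax ^ 2 + 4) + 8, by positivity, ?_⟩
  rintro ε ⟨hε, hε1⟩ σs σa ξ ζ₁ η ζ₂ f hs ha - hac hξ hη hη0 hζ hf heq hb0 hb1
  obtain ⟨F, Fx, hF, hFx, hFd, hFe, hFxe⟩ := exists_global_extension hf
  have hζ2 : ContDiffOn ℝ 1 (uncurry fun x (_ : ℝ) => ζ₁ x) (Icc (0:ℝ) 1 ×ˢ Icc (-1:ℝ) 1) :=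
    hζ.comp contDiff_fst.contDiffOn fun p hp => hp.1
  obtain ⟨Y, Yx, hY, hYx, hYd, hYe, hYxe⟩ := exists_global_extension hζ2
  obtain ⟨X, hX, hXe⟩ := exists_continuous_extension_Icc hξ
  obtain ⟨a, hac, hae⟩ := exists_continuous_extension_Icc hac
  obtain ⟨N, hN, hNe⟩ := exists_continuous_extension hη
  have mem0 : (0:ℝ) ∈ Icc (-1:ℝ) 1 := by norm_num
  set Z : ℝ → ℝ := fun x => Y x 0 with hZdef
  set Z' : ℝ → ℝ := fun x => Yx x 0 with hZ'def
  have hZ : Continuous Z := hY.comp (by fun_prop : Continuous fun x : ℝ => (x, (0:ℝ)))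
  have hZ' : Continuous Z' := hYx.comp (by fun_prop : Continuous fun x : ℝ => (x, (0:ℝ)))
  have hZd : ∀ x, HasDerivAt Z (Z' x) x := fun x => hYd x 0
  have hZe : ∀ x ∈ Icc (0:ℝ) 1, Z x = ζ₁ x := fun x hx => hYe x hx 0 mem0
  have hZ'e : ∀ x ∈ Ioo (0:ℝ) 1, Z' x = deriv ζ₁ x := fun x hx => hYxe x hx 0 mem0
  have hsl : ∀ {g : ℝ → ℝ → ℝ}, Continuous (uncurry g) → ∀ x, Continuous (g x) :=
    fun hg x => hg.comp (by fun_prop : Continuous fun v : ℝ => (x, v))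
  set h : ℝ → ℝ → ℝ := fun x v => F x v - Z x with hh
  set z : ℝ → ℝ := fun x => X x - a x * Z x with hz
  set e : ℝ → ℝ → ℝ := fun x v => N x v - v * Z' x with he
  have hzc : Continuous z := by fun_prop
  have hhc : Continuous (uncurry h) := by fun_prop
  have hec : Continuous (uncurry e) := by fun_prop
  have hξI : (∫ x in (0:ℝ)..1, (ξ x) ^ 2) = ∫ x in (0:ℝ)..1, (X x) ^ 2 := by
    refine intervalIntegral.integral_congr fun x hx => ?_
    rw [uIcc_of_le (by norm_num)] at hx
    simp only [hXe x hx]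
  have hζI : (∫ x in (0:ℝ)..1, (deriv ζ₁ x) ^ 2) = ∫ x in (0:ℝ)..1, (Z' x) ^ 2 :=
    intervalIntegral.integral_congr_Ioo_of_le zero_le_one fun x hx => by
      simp only [hZ'e x hx]
  rw [slab_integral_congr fun x hx v hv => (hFe x hx v hv).symm,
    slab_integral_congr fun x hx v hv => (hNe x hx v hv).symm, hξI, hζI,
    ← hZe 0 (by norm_num), ← hZe 1 (by norm_num)]
  have hvavg : ∀ x ∈ Icc (0:ℝ) 1, vavg h x = vavg f x - ζ₁ x := by
    intro x hx
    have h1 : vavg f x = vavg F x := by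
      unfold vavg
      congr 1
      refine intervalIntegral.integral_congr fun v hv => ?_
      rw [uIcc_of_le (by norm_num)] at hv
      exact (hFe x hx v hv).symm
    rw [h1, ← hZe x hx]
    simp only [vavg, hh]
    rw [intervalIntegral.integral_sub ((hsl hF x).intervalIntegrable _ _) (by simp)]
    simp only [intervalIntegral.integral_const, smul_eq_mul]
    ring
  have he0 : ∀ x ∈ Icc (0:ℝ) 1, (∫ v in (-1:ℝ)..1, e x v) = 0 := by
    intro x hx
    have h1 : (∫ v in (-1:ℝ)..1, N x v) = ∫ v in (-1:ℝ)..1, η x v := by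
      refine intervalIntegral.integral_congr fun v hv => ?_
      rw [uIcc_of_le (by norm_num)] at hv
      exact hNe x hx v hv
    have h2 := hη0 x hx
    unfold vavg at h2
    simp only [he]
    rw [intervalIntegral.integral_sub ((hsl hN x).intervalIntegrable _ _)
      (Continuous.intervalIntegrable (by fun_prop) _ _), h1,
      intervalIntegral.integral_mul_const, integral_id]
    linarith
  have hheq : ∀ x ∈ Ioo (0:ℝ) 1, ∀ v ∈ Icc (-1:ℝ) 1,
      ε * v * (Fx x v - Z' x)
        = σs x * (vavg h x - h x v) - ε ^ 2 * σa x * h x v + ε ^ 2 * z x + ε * e x v := by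
    intro x hx v hv
    have hx1 := Ioo_subset_Icc_self hx
    have h1 := heq x hx1 v hv
    rw [← hFxe x hx v hv, ← hXe x hx1, ← hNe x hx1 v hv, ← hFe x hx1 v hv] at h1
    rw [hvavg x hx1, ← hZe x hx1]
    simp only [hh, hz, he, hae x hx1]
    linear_combination h1
  set I0 := ∫ v in (0:ℝ)..1, (ζ₂ 0 v) ^ 2 with hI0
  set I1 := ∫ v in (-1:ℝ)..0, (ζ₂ 1 v) ^ 2 with hI1
  have hI : (∫ v in (0:ℝ)..1, (h 0 v) ^ 2) + (∫ v in (-1:ℝ)..0, (h 1 v) ^ 2)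
      = ε ^ 2 * (I0 + I1) := by
    rw [mul_add, hI0, hI1, ← intervalIntegral.integral_const_mul,
      ← intervalIntegral.integral_const_mul]
    congr 1
    · refine intervalIntegral.integral_congr_Ioo_of_le (by norm_num) fun v hv => ?_
      simp only [hh]
      rw [hFe 0 (by norm_num) v ⟨by linarith [hv.1], hv.2.le⟩, hZe 0 (by norm_num),
        hb0 v ⟨hv.1, hv.2.le⟩]
      ring
    · refine intervalIntegral.integral_congr_Ioo_of_le (by norm_num) fun v hv => ?_
      simp only [hh]
      rw [hFe 1 (by norm_num) v ⟨hv.1.le, by linarith [hv.2]⟩, hZe 1 (by norm_num),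
        hb1 v ⟨hv.1.le, hv.2⟩]
      ring
  have key := hmain ε ⟨hε, hε1⟩ σs σa z (vavg h) h (fun x v => Fx x v - Z' x) e (I0 + I1) hs ha
    hzc hhc (by fun_prop) hec (fun x v => (hFd x v).sub (hZd x)) rfl he0 hheq hI
  have hZI := integral_sq_le_endpoint hZ' hZd
  have bz : (∫ x in (0:ℝ)..1, (z x) ^ 2)
      ≤ 2 * (∫ x in (0:ℝ)..1, (X x) ^ 2) + 2 * σmax ^ 2 * ∫ x in (0:ℝ)..1, (Z x) ^ 2 := by
    rw [← intervalIntegral.integral_const_mul, ← intervalIntegral.integral_const_mul,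
      ← intervalIntegral.integral_add (Continuous.intervalIntegrable (by fun_prop) _ _)
        (Continuous.intervalIntegrable (by fun_prop) _ _)]
    refine intervalIntegral.integral_mono_on (by norm_num)
      (Continuous.intervalIntegrable (by fun_prop) _ _)
      (Continuous.intervalIntegrable (by fun_prop) _ _) fun x hx => ?_
    have ha2 : (a x) ^ 2 ≤ σmax ^ 2 := by
      rw [hae x hx]; exact pow_le_pow_left₀ (ha x hx).1 (ha x hx).2 2
    have := mul_le_mul_of_nonneg_right ha2 (sq_nonneg (Z x))
    simp only [hz]
    nlinarith [sq_nonneg (X x + a x * Z x)]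
  have be : (∫ x in (0:ℝ)..1, ∫ v in (-1:ℝ)..1, (e x v) ^ 2)
      ≤ 2 * (∫ x in (0:ℝ)..1, ∫ v in (-1:ℝ)..1, (N x v) ^ 2)
        + 4 * ∫ x in (0:ℝ)..1, (Z' x) ^ 2 := by
    rw [← intervalIntegral.integral_const_mul, ← intervalIntegral.integral_const_mul,
      ← intervalIntegral.integral_add (Continuous.intervalIntegrable (by fun_prop) _ _)
        (Continuous.intervalIntegrable (by fun_prop) _ _)]
    refine intervalIntegral.integral_mono_on (by norm_num)
      (Continuous.intervalIntegrable (by fun_prop) _ _)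
      (Continuous.intervalIntegrable (by fun_prop) _ _) fun x _ => ?_
    have hNx := hsl hN x
    have h4 : 4 * (Z' x) ^ 2 = ∫ v in (-1:ℝ)..1, 2 * (Z' x) ^ 2 := by
      rw [intervalIntegral.integral_const, smul_eq_mul]; ring
    rw [h4, ← intervalIntegral.integral_const_mul,
      ← intervalIntegral.integral_add (Continuous.intervalIntegrable (by fun_prop) _ _)
        (Continuous.intervalIntegrable (by fun_prop) _ _)]
    refine intervalIntegral.integral_mono_on (by norm_num)
      (Continuous.intervalIntegrable (by fun_prop) _ _)
      (Continuous.intervalIntegrable (by fun_prop) _ _) fun v hv => ?_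
    have := mul_le_mul_of_nonneg_right (sq_le_one_of_mem_Icc hv) (sq_nonneg (Z' x))
    simp only [he]
    nlinarith [sq_nonneg (N x v + v * Z' x)]
  have bF : (∫ x in (0:ℝ)..1, ∫ v in (-1:ℝ)..1, (F x v) ^ 2)
      ≤ 2 * (∫ x in (0:ℝ)..1, ∫ v in (-1:ℝ)..1, (h x v) ^ 2)
        + 4 * ∫ x in (0:ℝ)..1, (Z x) ^ 2 := by
    rw [← intervalIntegral.integral_const_mul, ← intervalIntegral.integral_const_mul,
      ← intervalIntegral.integral_add (Continuous.intervalIntegrable (by fun_prop) _ _)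
        (Continuous.intervalIntegrable (by fun_prop) _ _)]
    refine intervalIntegral.integral_mono_on (by norm_num)
      (Continuous.intervalIntegrable (by fun_prop) _ _)
      (Continuous.intervalIntegrable (by fun_prop) _ _) fun x _ => ?_
    have hFx' := hsl hF x
    have h4 : 4 * (Z x) ^ 2 = ∫ v in (-1:ℝ)..1, 2 * (Z x) ^ 2 := by
      rw [intervalIntegral.integral_const, smul_eq_mul]; ring
    rw [h4, ← intervalIntegral.integral_const_mul,
      ← intervalIntegral.integral_add (Continuous.intervalIntegrable (by fun_prop) _ _)
        (Continuous.intervalIntegrable (by fun_prop) _ _)]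
    refine intervalIntegral.integral_mono_on (by norm_num)
      (Continuous.intervalIntegrable (by fun_prop) _ _)
      (Continuous.intervalIntegrable (by fun_prop) _ _) fun v _ => ?_
    simp only [hh]
    nlinarith [sq_nonneg (F x v - 2 * Z x)]
  have hI0n : 0 ≤ I0 := intervalIntegral.integral_nonneg (by norm_num) fun v _ => sq_nonneg _
  have hI1n : 0 ≤ I1 := intervalIntegral.integral_nonneg (by norm_num) fun v _ => sq_nonneg _
  have hXn : 0 ≤ ∫ x in (0:ℝ)..1, (X x) ^ 2 :=
    intervalIntegral.integral_nonneg (by norm_num) fun v _ => sq_nonneg _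
  have hZn : 0 ≤ ∫ x in (0:ℝ)..1, (Z' x) ^ 2 :=
    intervalIntegral.integral_nonneg (by norm_num) fun v _ => sq_nonneg _
  have hNn : 0 ≤ ∫ x in (0:ℝ)..1, ∫ v in (-1:ℝ)..1, (N x v) ^ 2 :=
    intervalIntegral.integral_nonneg (by norm_num) fun v _ =>
      intervalIntegral.integral_nonneg (by norm_num) fun v _ => sq_nonneg _
  generalize (∫ x in (0:ℝ)..1, ∫ v in (-1:ℝ)..1, (F x v) ^ 2) = V at *
  generalize (∫ x in (0:ℝ)..1, ∫ v in (-1:ℝ)..1, (h x v) ^ 2) = W at *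
  generalize (∫ x in (0:ℝ)..1, ∫ v in (-1:ℝ)..1, (N x v) ^ 2) = N2 at *
  generalize (∫ x in (0:ℝ)..1, ∫ v in (-1:ℝ)..1, (e x v) ^ 2) = e2 at *
  generalize (∫ x in (0:ℝ)..1, (X x) ^ 2) = X2 at *
  generalize (∫ x in (0:ℝ)..1, (z x) ^ 2) = z2 at *
  generalize (∫ x in (0:ℝ)..1, (Z' x) ^ 2) = D2 at *
  generalize (∫ x in (0:ℝ)..1, (Z x) ^ 2) = Z2 at *
  have hεI : 0 ≤ ε * (I0 + I1) := mul_nonneg hε.le (add_nonneg hI0n hI1n)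
  have hz0 := sq_nonneg (Z 0)
  have hz1 := sq_nonneg (Z 1)
  have hσ2 := sq_nonneg σmax
  generalize Z 0 ^ 2 = p at *
  generalize Z 1 ^ 2 = q at *
  generalize ε * (I0 + I1) = J at *
  set S := X2 + N2 + p + q + D2 + J with hS
  have hZS : Z2 ≤ 2 * S := by linarith
  have hsum : z2 + e2 + J ≤ (2 + 4 * σmax ^ 2 + 4) * S := by
    have := mul_le_mul_of_nonneg_left hZS hσ2
    linarith
  have := mul_le_mul_of_nonneg_left hsum hC.le
  linarith
end

section
/- Uniform stability of the macro–micro PINN loss, isotropic boundary data (1D): assume σ_min ≤ σ_s(x) ≤ σ_max and 0 ≤ σ_a(x) ≤ σ_max on [0,1] with 0 < σ_min ≤ σ_max, and assume the inflow data are independent of v, i.e. φ(0,v) = a and φ(1,v) = b for constants a, b. Let (ρ*, g*) ∈ C¹([0,1]) × C¹(Ω) with ⟨g*⟩ ≡ 0 solve the macro–micro system, and set f* = ρ* + ε g*. Then there exist constants C > 0 and ε₀ ∈ (0,1] such that for every ε ∈ (0, ε₀] and every pair (ρ, g) ∈ C¹([0,1]) × C¹(Ω), with f = ρ + ε g, one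 has ∫₀¹∫_{−1}^{1} (f − f*)² dv dx ≤ C · E(ρ, g); that is, the L²-error is bounded by the loss uniformly in the Knudsen number ε. -/
open MeasureTheory Set Function

/-- The macro–micro PINN loss
`E(ρ,g) = ‖⟨v∂_x g⟩ + σ_a ρ − G‖² + ‖⟨g⟩‖²
  + ‖v∂_x(ρ+εg) − ε⟨v∂_x g⟩ − σ_s(⟨g⟩−g) + ε²σ_a g‖² + ‖ρ+εg−φ‖²_{L²(Γ₋)}`. -/
noncomputable def Eloss (ε : ℝ) (σs σa G : ℝ → ℝ) (φ : ℝ → ℝ → ℝ)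
    (ρ : ℝ → ℝ) (g : ℝ → ℝ → ℝ) : ℝ :=
  (∫ x in (0:ℝ)..1,
    (((1/2) * ∫ v in (-1:ℝ)..1, v * deriv (fun y => g y v) x)
      + σa x * ρ x - G x) ^ 2)
  + (∫ x in (0:ℝ)..1, (vavg g x) ^ 2)
  + (∫ x in (0:ℝ)..1, ∫ v in (-1:ℝ)..1,
      (v * deriv (fun y => ρ y + ε * g y v) x
        - ε * ((1/2) * ∫ w in (-1:ℝ)..1, w * deriv (fun y => g y w) x)
        - σs x * (vavg g x - g x v) + ε ^ 2 * σa x * g x v) ^ 2)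
  + (∫ v in (0:ℝ)..1, (ρ 0 + ε * g 0 v - φ 0 v) ^ 2)
  + (∫ v in (-1:ℝ)..0, (ρ 1 + ε * g 1 v - φ 1 v) ^ 2)

/-- The integral of a function that is pointwise bounded by a linear combination. -/
lemma integral_le_lincomb {a b : ℝ} (hab : a ≤ b) {f u₁ u₂ u₃ u₄ u₅ : ℝ → ℝ} (c₁ c₂ c₃ c₄ c₅ : ℝ)
    (hf : Continuous f) (h₁ : Continuous u₁) (h₂ : Continuous u₂) (h₃ : Continuous u₃)
    (h₄ : Continuous u₄) (h₅ : Continuous u₅)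
    (h : ∀ x ∈ Icc a b, f x ≤ c₁ * u₁ x + c₂ * u₂ x + c₃ * u₃ x + c₄ * u₄ x + c₅ * u₅ x) :
    ∫ x in a..b, f x ≤ c₁ * (∫ x in a..b, u₁ x) + c₂ * (∫ x in a..b, u₂ x)
      + c₃ * (∫ x in a..b, u₃ x) + c₄ * (∫ x in a..b, u₄ x)
      + c₅ * (∫ x in a..b, u₅ x) := by
  have i₁ := (h₁.const_mul c₁).intervalIntegrable (μ := volume) a b
  have i₂ := (h₂.const_mul c₂).intervalIntegrable (μ := volume) a b
  have i₃ := (h₃.const_mul c₃).intervalIntegrable (μ := volume) a b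
  have i₄ := (h₄.const_mul c₄).intervalIntegrable (μ := volume) a b
  have i₅ := (h₅.const_mul c₅).intervalIntegrable (μ := volume) a b
  simp only [← intervalIntegral.integral_const_mul]
  rw [← intervalIntegral.integral_add i₁ i₂, ← intervalIntegral.integral_add (i₁.add i₂) i₃,
    ← intervalIntegral.integral_add ((i₁.add i₂).add i₃) i₄,
    ← intervalIntegral.integral_add (((i₁.add i₂).add i₃).add i₄) i₅]
  exact intervalIntegral.integral_mono_on hab (hf.intervalIntegrable _ _)
    ((((i₁.add i₂).add i₃).add i₄).add i₅) h

/-- The integral of a pointwise linear combination. -/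
lemma integral_eq_lincomb {a b : ℝ} (hab : a ≤ b) {f u₁ u₂ u₃ u₄ u₅ : ℝ → ℝ} (c₁ c₂ c₃ c₄ c₅ : ℝ)
    (hf : Continuous f) (h₁ : Continuous u₁) (h₂ : Continuous u₂) (h₃ : Continuous u₃)
    (h₄ : Continuous u₄) (h₅ : Continuous u₅)
    (h : ∀ x ∈ Icc a b, f x = c₁ * u₁ x + c₂ * u₂ x + c₃ * u₃ x + c₄ * u₄ x + c₅ * u₅ x) :
    ∫ x in a..b, f x = c₁ * (∫ x in a..b, u₁ x) + c₂ * (∫ x in a..b, u₂ x)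
      + c₃ * (∫ x in a..b, u₃ x) + c₄ * (∫ x in a..b, u₄ x)
      + c₅ * (∫ x in a..b, u₅ x) := by
  refine le_antisymm (integral_le_lincomb hab c₁ c₂ c₃ c₄ c₅ hf h₁ h₂ h₃ h₄ h₅
    fun x hx => (h x hx).le) ?_
  have := integral_le_lincomb hab (f := fun x => -f x) (-c₁) (-c₂) (-c₃) (-c₄) (-c₅)
    hf.neg h₁ h₂ h₃ h₄ h₅ fun x hx => by rw [h x hx]; linarith
  rw [intervalIntegral.integral_neg] at this
  linarith

/-- Cauchy–Schwarz inequality against the constant function. -/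
lemma sq_integral_le {a b : ℝ} (hab : a ≤ b) {u : ℝ → ℝ} (hu : Continuous u) :
    (∫ x in a..b, u x) ^ 2 ≤ (b - a) * ∫ x in a..b, (u x) ^ 2 := by
  rcases hab.eq_or_lt with rfl | hlt
  · simp
  set t := (∫ x in a..b, u x) / (b - a) with ht
  have key := integral_eq_lincomb hab (f := fun x => (u x - t) ^ 2) (u₁ := fun x => u x ^ 2)
    (u₂ := u) (u₃ := fun _ => 1) (u₄ := fun _ => 0) (u₅ := fun _ => 0) 1 (-2 * t) (t ^ 2) 0 0
    (by fun_prop) (by fun_prop) hu (by fun_prop) (by fun_prop) (by fun_prop) (fun x _ => by ring)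
  have h0 : 0 ≤ ∫ x in a..b, (u x - t) ^ 2 :=
    intervalIntegral.integral_nonneg hab fun x _ => sq_nonneg _
  rw [key] at h0
  simp only [intervalIntegral.integral_const, smul_eq_mul, mul_one] at h0
  have hb : 0 < b - a := sub_pos.2 hlt
  have hI : (∫ x in a..b, u x) = t * (b - a) := by rw [ht]; field_simp
  rw [hI] at h0 ⊢
  nlinarith

/-- Poincaré inequality on the unit interval. -/
lemma poincare_unitInterval {Q Q' : ℝ → ℝ} (hQ : ∀ x, HasDerivAt Q (Q' x) x) (hQ' : Continuous Q')
    (h0 : Q 0 = 0) : ∫ x in (0:ℝ)..1, Q x ^ 2 ≤ ∫ x in (0:ℝ)..1, Q' x ^ 2 := by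
  have hQc : Continuous Q := continuous_iff_continuousAt.2 fun x => (hQ x).continuousAt
  have hpt : ∀ x ∈ Icc (0:ℝ) 1, Q x ^ 2 ≤ ∫ y in (0:ℝ)..1, Q' y ^ 2 := by
    intro x hx
    have h1 : ∫ y in (0:ℝ)..x, Q' y = Q x := by
      rw [intervalIntegral.integral_eq_sub_of_hasDerivAt (fun y _ => hQ y)
        (hQ'.intervalIntegrable _ _), h0, sub_zero]
    have h2 := sq_integral_le hx.1 hQ'
    have h3 : ∫ y in (0:ℝ)..x, Q' y ^ 2 ≤ ∫ y in (0:ℝ)..1, Q' y ^ 2 :=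
      intervalIntegral.integral_mono_interval le_rfl hx.1 hx.2
        (ae_of_all _ fun y => sq_nonneg _) ((hQ'.pow 2).intervalIntegrable _ _)
    have h4 : 0 ≤ ∫ y in (0:ℝ)..x, Q' y ^ 2 :=
      intervalIntegral.integral_nonneg hx.1 fun y _ => sq_nonneg _
    rw [h1] at h2
    nlinarith [hx.1, hx.2]
  calc _ ≤ ∫ _x in (0:ℝ)..1, ∫ y in (0:ℝ)..1, Q' y ^ 2 :=
        intervalIntegral.integral_mono_on zero_le_one ((hQc.pow 2).intervalIntegrable _ _)
          (by simp) hpt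
    _ = _ := by simp

/-- Differentiation under the integral sign for jointly continuous derivatives. -/
lemma hasDerivAt_integral_of_continuous {F F' : ℝ → ℝ → ℝ} (hF : Continuous (uncurry F))
    (hF' : Continuous (uncurry F')) (hd : ∀ x v, HasDerivAt (fun y => F y v) (F' x v) x)
    (a b x : ℝ) :
    HasDerivAt (fun y => ∫ v in a..b, F y v) (∫ v in a..b, F' x v) x := by
  obtain ⟨K, hK⟩ := ((isCompact_Icc (a := x - 1) (b := x + 1)).prod
    (isCompact_uIcc (a := a) (b := b))).exists_bound_of_continuousOn hF'.continuousOn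
  have hFx : ∀ y, Continuous (F y) := fun y => hF.comp (by fun_prop : Continuous fun v => (y, v))
  have hFx' : ∀ y, Continuous (F' y) := fun y => hF'.comp (by fun_prop : Continuous fun v => (y, v))
  refine (intervalIntegral.hasDerivAt_integral_of_dominated_loc_of_deriv_le
    (bound := fun _ => K) (s := Icc (x - 1) (x + 1)) (Icc_mem_nhds (by linarith) (by linarith))
    (.of_forall fun y => (hFx y).aestronglyMeasurable) ((hFx x).intervalIntegrable _ _)
    (hFx' x).aestronglyMeasurable (ae_of_all _ fun v hv y hy => ?_) (by simp)
    (ae_of_all _ fun v _ y _ => hd y v)).2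
  exact hK (y, v) ⟨hy, uIoc_subset_uIcc hv⟩

/-- A `C¹` function on the phase space agrees there with a function on the plane that is
continuously differentiable in the first variable. -/
lemma C1Omega.exists_extension {g : ℝ → ℝ → ℝ} (hg : C1Omega g) :
    ∃ h h' : ℝ → ℝ → ℝ, Continuous (uncurry h) ∧ Continuous (uncurry h') ∧
      (∀ x v, HasDerivAt (fun y => h y v) (h' x v) x) ∧
      ∀ x ∈ Icc (0:ℝ) 1, ∀ v ∈ Icc (-1:ℝ) 1, g x v = h x v := by
  set S := Icc (0:ℝ) 1 ×ˢ Icc (-1:ℝ) 1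
  have hS : UniqueDiffOn ℝ S :=
    (uniqueDiffOn_Icc (by norm_num)).prod (uniqueDiffOn_Icc (by norm_num))
  set D : ℝ × ℝ → ℝ := fun p => fderivWithin ℝ (uncurry g) S p (1, 0)
  have hD : ContinuousOn D S :=
    (hg.continuousOn_fderivWithin hS le_rfl).clm_apply continuousOn_const
  have h01 : (0:ℝ) ≤ 1 := zero_le_one
  have h11 : (-1:ℝ) ≤ 1 := by norm_num
  set px : ℝ → ℝ := fun x => projIcc 0 1 h01 x
  set pv : ℝ → ℝ := fun v => projIcc (-1) 1 h11 v
  have hpx : Continuous px := continuous_subtype_val.comp continuous_projIcc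
  have hpv : Continuous pv := continuous_subtype_val.comp continuous_projIcc
  have hpxm : ∀ x, px x ∈ Icc (0:ℝ) 1 := fun x => (projIcc 0 1 h01 x).2
  have hpvm : ∀ v, pv v ∈ Icc (-1:ℝ) 1 := fun v => (projIcc (-1) 1 h11 v).2
  have hpxe : ∀ x ∈ Icc (0:ℝ) 1, px x = x := fun x hx => by simp [px, projIcc_of_mem h01 hx]
  have hpve : ∀ v ∈ Icc (-1:ℝ) 1, pv v = v := fun v hv => by simp [pv, projIcc_of_mem h11 hv]
  have hd : Continuous fun p : ℝ × ℝ => D (px p.1, pv p.2) :=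
    hD.comp_continuous (by fun_prop) fun p => ⟨hpxm _, hpvm _⟩
  have hg0 : Continuous fun v => g 0 (pv v) :=
    hg.continuousOn.comp_continuous (f := fun v => ((0:ℝ), pv v)) (by fun_prop)
      fun v => ⟨by simp, hpvm _⟩
  have hdv : ∀ v, Continuous fun x => D (px x, pv v) := fun v =>
    hd.comp (by fun_prop : Continuous fun x : ℝ => (x, v))
  refine ⟨fun x v => g 0 (pv v) + ∫ t in (0:ℝ)..x, D (px t, pv v),
    fun x v => D (px x, pv v), ?_, hd, fun x v => ?_, fun x hx v hv => ?_⟩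
  · refine (hg0.comp continuous_snd).add ?_
    exact intervalIntegral.continuous_parametric_intervalIntegral_of_continuous
      (f := fun (p : ℝ × ℝ) t => D (px t, pv p.2)) (s := Prod.fst)
      (hd.comp (by fun_prop : Continuous fun q : (ℝ × ℝ) × ℝ => (q.2, q.1.2))) continuous_fst
  · exact ((hdv v).integral_hasStrictDerivAt 0 x).hasDerivAt.const_add _
  · have hder : ∀ y ∈ Icc (0:ℝ) 1,
        HasDerivWithinAt (fun z => g z v) (D (y, v)) (Icc (0:ℝ) 1) y := by
      intro y hy
      have h1 := ((hg.differentiableOn one_ne_zero) (y, v) ⟨hy, hv⟩).hasFDerivWithinAt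
      have h2 : HasDerivWithinAt (fun z : ℝ => (z, v)) ((1:ℝ), (0:ℝ)) (Icc (0:ℝ) 1) y :=
        ((hasDerivAt_id y).prodMk (hasDerivAt_const y v)).hasDerivWithinAt
      exact h1.comp_hasDerivWithinAt y h2
        (show MapsTo (fun z : ℝ => (z, v)) (Icc 0 1) S from fun z hz => ⟨hz, hv⟩)
    have hint := intervalIntegral.integral_eq_sub_of_hasDerivAt_of_le (f := fun z => g z v)
      (f' := fun z => D (px z, pv v)) hx.1
      (fun y hy => ((hder y ⟨hy.1, hy.2.trans hx.2⟩).continuousWithinAt).mono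
        (Icc_subset_Icc_right hx.2))
      (fun y hy => by
        have hy' : y ∈ Icc (0:ℝ) 1 := ⟨hy.1.le, hy.2.le.trans hx.2⟩
        rw [hpxe y hy', hpve v hv]
        exact (hder y hy').hasDerivAt (Icc_mem_nhds hy.1 (hy.2.trans_le hx.2)))
      ((hdv v).intervalIntegrable _ _)
    change g x v = g 0 (pv v) + ∫ t in (0:ℝ)..x, D (px t, pv v)
    rw [hint, hpve v hv]
    ring

/-- A priori bound for the first-order form of a one-dimensional diffusion equation with
homogeneous boundary values. -/
lemma exists_diffusion_bound_of_zero_boundary {m M : ℝ} (hm : 0 < m) (hM : 0 < M) :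
    ∃ C > 0, ∀ κ α Q J p z : ℝ → ℝ, Continuous κ → Continuous α → Continuous p → Continuous z →
      (∀ x, m ≤ κ x ∧ κ x ≤ M) → (∀ x, 0 ≤ α x) →
      (∀ x, HasDerivAt Q (-(κ x * J x) + p x) x) →
      (∀ x, HasDerivAt J (-(3 * α x * Q x) + z x) x) → Q 0 = 0 → Q 1 = 0 →
      ∫ x in (0:ℝ)..1, Q x ^ 2 ≤
        C * ((∫ x in (0:ℝ)..1, p x ^ 2) + ∫ x in (0:ℝ)..1, z x ^ 2) := by
  set η := m / (8 * M ^ 2) with hη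
  have hη0 : 0 < η := by positivity
  have hηM : η * (2 * M ^ 2) = m / 4 := by rw [hη]; field_simp; ring
  set k₁ := 2 / m * (1 / m + 2 * η) with hk₁
  set k₂ := 2 / m * (1 / (4 * η)) with hk₂
  have hk₁0 : 0 < k₁ := by positivity
  have hk₂0 : 0 < k₂ := by positivity
  refine ⟨2 * M ^ 2 * (k₁ + k₂) + 2, by positivity, ?_⟩
  intro κ α Q J p z hκ hα hpc hzc hκb hαb hQd hJd hQ0 hQ1
  have hQc : Continuous Q := continuous_iff_continuousAt.2 fun x => (hQd x).continuousAt
  have hJc : Continuous J := continuous_iff_continuousAt.2 fun x => (hJd x).continuousAt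
  have hpoin := poincare_unitInterval hQd (by fun_prop) hQ0
  have hQ' : ∫ x in (0:ℝ)..1, (-(κ x * J x) + p x) ^ 2 ≤ _ :=
    integral_le_lincomb zero_le_one (u₁ := fun x => J x ^ 2) (u₂ := fun x => p x ^ 2)
      (u₃ := fun _ => 0) (u₄ := fun _ => 0) (u₅ := fun _ => 0) (2 * M ^ 2) 2 0 0 0
      (by fun_prop) (by fun_prop) (by fun_prop) (by fun_prop) (by fun_prop) (by fun_prop)
      fun x _ => by
        have h1 : κ x ^ 2 ≤ M ^ 2 := pow_le_pow_left₀ (hm.le.trans (hκb x).1) (hκb x).2 2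
        nlinarith [sq_nonneg (κ x * J x + p x), mul_le_mul_of_nonneg_right h1 (sq_nonneg (J x))]
  have hzero : ∫ x in (0:ℝ)..1,
      ((-(κ x * J x) + p x) * J x + Q x * (-(3 * α x * Q x) + z x)) = 0 := by
    rw [intervalIntegral.integral_eq_sub_of_hasDerivAt (fun x _ => (hQd x).mul (hJd x))
      (Continuous.intervalIntegrable (by fun_prop) _ _)]
    simp [hQ0, hQ1]
  have hen : ∫ x in (0:ℝ)..1,
      ((-(κ x * J x) + p x) * J x + Q x * (-(3 * α x * Q x) + z x)) ≤ _ :=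
    integral_le_lincomb zero_le_one (u₁ := fun x => J x ^ 2) (u₂ := fun x => p x ^ 2)
      (u₃ := fun x => Q x ^ 2) (u₄ := fun x => z x ^ 2) (u₅ := fun _ => 0)
      (-(3 / 4 * m)) (1 / m) η (1 / (4 * η)) 0
      (by fun_prop) (by fun_prop) (by fun_prop) (by fun_prop) (by fun_prop) (by fun_prop)
      fun x _ => by
        have h1 : p x * J x ≤ m / 4 * J x ^ 2 + 1 / m * p x ^ 2 := by
          have : m / 4 * J x ^ 2 + 1 / m * p x ^ 2 - p x * J x
            = 1 / m * (p x - m / 2 * J x) ^ 2 := by field_simp; ring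
          have : 0 ≤ 1 / m * (p x - m / 2 * J x) ^ 2 := by positivity
          linarith
        have h2 : Q x * z x ≤ η * Q x ^ 2 + 1 / (4 * η) * z x ^ 2 := by
          have : η * Q x ^ 2 + 1 / (4 * η) * z x ^ 2 - Q x * z x
            = 1 / (4 * η) * (z x - 2 * η * Q x) ^ 2 := by field_simp; ring
          have : 0 ≤ 1 / (4 * η) * (z x - 2 * η * Q x) ^ 2 := by positivity
          linarith
        have h3 := mul_le_mul_of_nonneg_right (hκb x).1 (sq_nonneg (J x))
        have h4 := mul_nonneg (hαb x) (sq_nonneg (Q x))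
        nlinarith
  have hp0 : 0 ≤ ∫ x in (0:ℝ)..1, p x ^ 2 :=
    intervalIntegral.integral_nonneg zero_le_one fun x _ => sq_nonneg _
  have hz0 : 0 ≤ ∫ x in (0:ℝ)..1, z x ^ 2 :=
    intervalIntegral.integral_nonneg zero_le_one fun x _ => sq_nonneg _
  have hIQ := hpoin.trans hQ'
  rw [hzero] at hen
  simp only [intervalIntegral.integral_const, smul_eq_mul, mul_zero, add_zero] at hIQ hen
  generalize (∫ x in (0:ℝ)..1, Q x ^ 2) = IQ at *
  generalize (∫ x in (0:ℝ)..1, J x ^ 2) = IJ at *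
  generalize (∫ x in (0:ℝ)..1, p x ^ 2) = Ip at *
  generalize (∫ x in (0:ℝ)..1, z x ^ 2) = Iz at *
  have h1 : m / 2 * IJ ≤ (1 / m + 2 * η) * Ip + 1 / (4 * η) * Iz := by
    have h := mul_le_mul_of_nonneg_left hIQ hη0.le
    rw [mul_add, ← mul_assoc, hηM] at h
    linarith
  have h2 : IJ ≤ k₁ * Ip + k₂ * Iz := by
    have h := mul_le_mul_of_nonneg_left h1 (by positivity : (0:ℝ) ≤ 2 / m)
    have h' : 2 / m * (m / 2 * IJ) = IJ := by field_simp
    rw [h'] at h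
    rw [hk₁, hk₂]; linarith
  have h3 := mul_le_mul_of_nonneg_left h2 (by positivity : (0:ℝ) ≤ 2 * M ^ 2)
  have h4 : 0 ≤ 2 * M ^ 2 * (k₂ * Ip + k₁ * Iz) := by positivity
  linarith

/-- A priori bound for the first-order form of a one-dimensional diffusion equation. -/
lemma exists_diffusion_bound {m M : ℝ} (hm : 0 < m) (hM : 0 < M) :
    ∃ C > 0, ∀ κ α P J q s : ℝ → ℝ, Continuous κ → Continuous α → Continuous q → Continuous s →
      (∀ x, m ≤ κ x ∧ κ x ≤ M) → (∀ x, 0 ≤ α x ∧ α x ≤ M) →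
      (∀ x, HasDerivAt P (-(κ x * J x) + q x) x) →
      (∀ x, HasDerivAt J (-(3 * α x * P x) + s x) x) →
      ∫ x in (0:ℝ)..1, P x ^ 2 ≤
        C * ((∫ x in (0:ℝ)..1, q x ^ 2) + (∫ x in (0:ℝ)..1, s x ^ 2) + (P 0 ^ 2 + P 1 ^ 2)) := by
  obtain ⟨K, hK, hbound⟩ := exists_diffusion_bound_of_zero_boundary hm hM
  refine ⟨2 * K * (4 + 18 * M ^ 2) + 2, by positivity, ?_⟩
  intro κ α P J q s hκ hα hq hs hκb hαb hP hJ
  have hPc : Continuous P := continuous_iff_continuousAt.2 fun x => (hP x).continuousAt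
  set d := P 1 - P 0 with hd
  set b := P 0 ^ 2 + P 1 ^ 2 with hb
  have hb0 : 0 ≤ b := by positivity
  set l : ℝ → ℝ := fun x => P 0 + d * x with hl
  have hlc : Continuous l := by fun_prop
  have hlb : ∀ x ∈ Icc (0:ℝ) 1, l x ^ 2 ≤ b := fun x hx => by
    have h1 : l x ^ 2 = (1 - x) * P 0 ^ 2 + x * P 1 ^ 2 - x * (1 - x) * d ^ 2 := by
      simp only [hl, hd]; ring
    have h2 : 0 ≤ x * (1 - x) * d ^ 2 :=
      mul_nonneg (mul_nonneg hx.1 (sub_nonneg.2 hx.2)) (sq_nonneg d)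
    nlinarith [mul_nonneg hx.1 (sq_nonneg (P 0)),
      mul_nonneg (sub_nonneg.2 hx.2) (sq_nonneg (P 1))]
  have hQ := hbound κ α (fun x => P x - l x) J (fun x => q x - d) (fun x => s x - 3 * α x * l x)
    hκ hα (by fun_prop) (by fun_prop) hκb (fun x => (hαb x).1)
    (fun x => ((hP x).sub (((hasDerivAt_id x).const_mul d).const_add (P 0))).congr_deriv (by ring))
    (fun x => (hJ x).congr_deriv (by ring)) (by simp [hl]) (by simp [hl, hd])
  have hpb : ∫ x in (0:ℝ)..1, (q x - d) ^ 2 ≤ _ :=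
    integral_le_lincomb zero_le_one (u₁ := fun x => q x ^ 2) (u₂ := fun _ => 1)
      (u₃ := fun _ => 0) (u₄ := fun _ => 0) (u₅ := fun _ => 0) 2 (4 * b) 0 0 0
      (by fun_prop) (by fun_prop) (by fun_prop) (by fun_prop) (by fun_prop) (by fun_prop)
      fun x _ => by
        simp only [hb, hd]
        nlinarith [sq_nonneg (q x + (P 1 - P 0)), sq_nonneg (P 1 + P 0)]
  have hzb : ∫ x in (0:ℝ)..1, (s x - 3 * α x * l x) ^ 2 ≤ _ :=
    integral_le_lincomb zero_le_one (u₁ := fun x => s x ^ 2) (u₂ := fun _ => 1)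
      (u₃ := fun _ => 0) (u₄ := fun _ => 0) (u₅ := fun _ => 0) 2 (18 * M ^ 2 * b) 0 0 0
      (by fun_prop) (by fun_prop) (by fun_prop) (by fun_prop) (by fun_prop) (by fun_prop)
      fun x hx => by
        have h1 : α x ^ 2 ≤ M ^ 2 := pow_le_pow_left₀ (hαb x).1 (hαb x).2 2
        have h2 : α x ^ 2 * l x ^ 2 ≤ M ^ 2 * b :=
          mul_le_mul h1 (hlb x hx) (sq_nonneg _) (sq_nonneg _)
        nlinarith [sq_nonneg (s x + 3 * α x * l x)]
  have hPb : ∫ x in (0:ℝ)..1, P x ^ 2 ≤ _ :=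
    integral_le_lincomb zero_le_one (u₁ := fun x => (P x - l x) ^ 2) (u₂ := fun _ => 1)
      (u₃ := fun _ => 0) (u₄ := fun _ => 0) (u₅ := fun _ => 0) 2 (2 * b) 0 0 0
      (by fun_prop) (by fun_prop) (by fun_prop) (by fun_prop) (by fun_prop) (by fun_prop)
      fun x hx => by nlinarith [sq_nonneg (P x - 2 * l x), hlb x hx]
  have hq0 : 0 ≤ ∫ x in (0:ℝ)..1, q x ^ 2 :=
    intervalIntegral.integral_nonneg zero_le_one fun x _ => sq_nonneg _
  have hs0 : 0 ≤ ∫ x in (0:ℝ)..1, s x ^ 2 :=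
    intervalIntegral.integral_nonneg zero_le_one fun x _ => sq_nonneg _
  simp only [intervalIntegral.integral_const, smul_eq_mul, mul_one, mul_zero, sub_zero,
    add_zero] at hpb hzb hPb
  have h1 := mul_le_mul_of_nonneg_left (add_le_add hpb hzb) hK.le
  have h2 : 0 ≤ K * (2 * (∫ x in (0:ℝ)..1, q x ^ 2) + 2 * (∫ x in (0:ℝ)..1, s x ^ 2)
    + 18 * M ^ 2 * ((∫ x in (0:ℝ)..1, q x ^ 2) + (∫ x in (0:ℝ)..1, s x ^ 2))) := by positivity
  linarith

/-- The system satisfied by the difference `F` of two densities whose macro–micro residuals are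
`A` (macro equation), `μ` (zero-average constraint) and `T` (micro equation). -/
structure KineticErrorSystem (ε m M : ℝ) (σs σa A μ : ℝ → ℝ) (F F' T : ℝ → ℝ → ℝ) : Prop where
  eps_pos : 0 < ε
  eps_le : ε ≤ 1
  m_pos : 0 < m
  M_pos : 0 < M
  σs_cont : Continuous σs
  σa_cont : Continuous σa
  A_cont : Continuous A
  μ_cont : Continuous μ
  F_cont : Continuous (uncurry F)
  F'_cont : Continuous (uncurry F')
  T_cont : Continuous (uncurry T)
  σs_bound : ∀ x, m ≤ σs x ∧ σs x ≤ M
  σa_bound : ∀ x, 0 ≤ σa x ∧ σa x ≤ M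
  hasDerivAt : ∀ x v, HasDerivAt (fun y => F y v) (F' x v) x
  kinetic : ∀ x v, ε * v * F' x v
    = σs x * (vavg F x - F x v) - ε ^ 2 * σa x * F x v + ε * T x v + ε ^ 2 * A x
  avg_T : ∀ x, vavg T x = ε ^ 2 * σa x * μ x

namespace KineticErrorSystem

variable {ε m M : ℝ} {σs σa A μ : ℝ → ℝ} {F F' T : ℝ → ℝ → ℝ}

lemma F_slice (h : KineticErrorSystem ε m M σs σa A μ F F' T) (x : ℝ) : Continuous (F x) :=
  h.F_cont.comp (by fun_prop : Continuous fun v => (x, v))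

lemma F'_slice (h : KineticErrorSystem ε m M σs σa A μ F F' T) (x : ℝ) : Continuous (F' x) :=
  h.F'_cont.comp (by fun_prop : Continuous fun v => (x, v))

lemma T_slice (h : KineticErrorSystem ε m M σs σa A μ F F' T) (x : ℝ) : Continuous (T x) :=
  h.T_cont.comp (by fun_prop : Continuous fun v => (x, v))

lemma vavg_cont (h : KineticErrorSystem ε m M σs σa A μ F F' T) : Continuous (vavg F) := by
  have := h.F_cont
  unfold vavg
  fun_prop

lemma integral_F (F : ℝ → ℝ → ℝ) (x : ℝ) : ∫ v in (-1:ℝ)..1, F x v = 2 * vavg F x := by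
  unfold vavg; ring

lemma integral_T (h : KineticErrorSystem ε m M σs σa A μ F F' T) (x : ℝ) :
    ∫ v in (-1:ℝ)..1, T x v = 2 * (ε ^ 2 * σa x * μ x) := by
  rw [← h.avg_T]; unfold vavg; ring

/-- The scaled flux satisfies the continuity equation. -/
lemma hasDerivAt_flux (h : KineticErrorSystem ε m M σs σa A μ F F' T) (x : ℝ) :
    HasDerivAt (fun y => 1 / (2 * ε) * ∫ v in (-1:ℝ)..1, v * F y v)
      (-(σa x * vavg F x) + ε * σa x * μ x + A x) x := by
  have hF := h.F_cont
  have hF' := h.F'_cont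
  have hFx := h.F_slice x
  have hF'x := h.F'_slice x
  have hTx := h.T_slice x
  have hε := h.eps_pos
  refine ((hasDerivAt_integral_of_continuous (F := fun y v => v * F y v)
    (F' := fun y v => v * F' y v) (by fun_prop) (by fun_prop)
    (fun y v => (h.hasDerivAt y v).const_mul v) (-1) 1 x).const_mul _).congr_deriv ?_
  have key := integral_eq_lincomb (by norm_num : (-1:ℝ) ≤ 1) (f := fun v => ε * (v * F' x v))
    (u₁ := F x) (u₂ := T x) (u₃ := fun _ => 1) (u₄ := fun _ => 0) (u₅ := fun _ => 0)
    (-σs x - ε ^ 2 * σa x) ε (σs x * vavg F x + ε ^ 2 * A x) 0 0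
    (by fun_prop) hFx hTx (by fun_prop) (by fun_prop) (by fun_prop)
    (fun v _ => by have := h.kinetic x v; linarith)
  rw [intervalIntegral.integral_const_mul, h.integral_T, integral_F] at key
  simp only [intervalIntegral.integral_const, smul_eq_mul] at key
  have : (∫ v in (-1:ℝ)..1, v * F' x v)
      = 2 * ε * (-(σa x * vavg F x) + ε * σa x * μ x + A x) := by
    apply mul_left_cancel₀ hε.ne'
    rw [key]; ring
  rw [this]
  field_simp

/-- The second moment satisfies Fick's law up to the micro residual. -/
lemma hasDerivAt_pressure (h : KineticErrorSystem ε m M σs σa A μ F F' T) (x : ℝ) :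
    HasDerivAt (fun y => 1 / 2 * ∫ v in (-1:ℝ)..1, v ^ 2 * F y v)
      (-((σs x + ε ^ 2 * σa x) * (1 / (2 * ε) * ∫ v in (-1:ℝ)..1, v * F x v))
        + 1 / 2 * ∫ v in (-1:ℝ)..1, v * T x v) x := by
  have hF := h.F_cont
  have hF' := h.F'_cont
  have hFx := h.F_slice x
  have hF'x := h.F'_slice x
  have hTx := h.T_slice x
  have hε := h.eps_pos
  refine ((hasDerivAt_integral_of_continuous (F := fun y v => v ^ 2 * F y v)
    (F' := fun y v => v ^ 2 * F' y v) (by fun_prop) (by fun_prop)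
    (fun y v => (h.hasDerivAt y v).const_mul (v ^ 2)) (-1) 1 x).const_mul _).congr_deriv ?_
  have key := integral_eq_lincomb (by norm_num : (-1:ℝ) ≤ 1) (f := fun v => ε * (v ^ 2 * F' x v))
    (u₁ := fun v => v * F x v) (u₂ := fun v => v * T x v) (u₃ := fun v => v) (u₄ := fun _ => 0)
    (u₅ := fun _ => 0)
    (-σs x - ε ^ 2 * σa x) ε (σs x * vavg F x + ε ^ 2 * A x) 0 0
    (by fun_prop) (by fun_prop) (by fun_prop) (by fun_prop) (by fun_prop) (by fun_prop)
    (fun v _ => by linear_combination v * h.kinetic x v)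
  rw [intervalIntegral.integral_const_mul] at key
  simp only [integral_id, intervalIntegral.integral_const, smul_eq_mul] at key
  have : (∫ v in (-1:ℝ)..1, v ^ 2 * F' x v) = 1 / ε * (-(σs x + ε ^ 2 * σa x)
      * (∫ v in (-1:ℝ)..1, v * F x v)) + ∫ v in (-1:ℝ)..1, v * T x v := by
    apply mul_left_cancel₀ hε.ne'
    rw [key]; field_simp; ring
  rw [this]
  field_simp

/-- Local energy dissipation. -/
lemma local_energy (h : KineticErrorSystem ε m M σs σa A μ F F' T) {δ : ℝ} (hδ : 0 < δ) (x : ℝ) :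
    ε * (∫ v in (-1:ℝ)..1, v * (F x v * F' x v))
        + m / 2 * ∫ v in (-1:ℝ)..1, (F x v - vavg F x) ^ 2
      ≤ ε ^ 2 * (1 / (2 * m) * (∫ v in (-1:ℝ)..1, T x v ^ 2) + 2 * M ^ 2 / δ * μ x ^ 2
        + 2 / δ * A x ^ 2 + δ * vavg F x ^ 2) := by
  have hFx := h.F_slice x
  have hF'x := h.F'_slice x
  have hTx := h.T_slice x
  have hε := h.eps_pos
  have hm := h.m_pos
  set N := vavg F x with hN
  have key := integral_le_lincomb (by norm_num : (-1:ℝ) ≤ 1)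
    (f := fun v => ε * (v * (F x v * F' x v)))
    (u₁ := fun v => (F x v - N) ^ 2) (u₂ := fun v => T x v ^ 2) (u₃ := F x) (u₄ := T x)
    (u₅ := fun _ => 1) (-(m / 2)) (ε ^ 2 * (1 / (2 * m))) (-(σs x * N) + ε ^ 2 * A x) (ε * N)
    (σs x * N ^ 2)
    (by fun_prop) (by fun_prop) (by fun_prop) (by fun_prop) (by fun_prop) (by fun_prop)
    (fun v _ => by
      have h1 : ε * T x v * (F x v - N)
          ≤ m / 2 * (F x v - N) ^ 2 + ε ^ 2 * (1 / (2 * m)) * T x v ^ 2 := by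
        have : m / 2 * (F x v - N) ^ 2 + ε ^ 2 * (1 / (2 * m)) * T x v ^ 2
          - ε * T x v * (F x v - N) = 1 / (2 * m) * (ε * T x v - m * (F x v - N)) ^ 2 := by
          field_simp; ring
        have : 0 ≤ 1 / (2 * m) * (ε * T x v - m * (F x v - N)) ^ 2 := by positivity
        linarith
      have h2 := mul_le_mul_of_nonneg_right (h.σs_bound x).1 (sq_nonneg (F x v - N))
      have h3 : 0 ≤ ε ^ 2 * (σa x * F x v ^ 2) :=
        mul_nonneg (sq_nonneg _) (mul_nonneg (h.σa_bound x).1 (sq_nonneg _))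
      have h4 : ε * (v * (F x v * F' x v)) = F x v *
          (σs x * (N - F x v) - ε ^ 2 * σa x * F x v + ε * T x v + ε ^ 2 * A x) := by
        rw [hN, ← h.kinetic x v]; ring
      rw [h4]
      linarith)
  rw [intervalIntegral.integral_const_mul, h.integral_T, integral_F, ← hN] at key
  simp only [intervalIntegral.integral_const, smul_eq_mul] at key
  have h1 : 2 * (ε * σa x * μ x) * N ≤ δ / 2 * N ^ 2 + 2 * M ^ 2 / δ * μ x ^ 2 := by
    have e : δ / 2 * N ^ 2 + 2 / δ * (ε * σa x * μ x) ^ 2 - 2 * (ε * σa x * μ x) * N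
      = 2 / δ * (ε * σa x * μ x - δ / 2 * N) ^ 2 := by field_simp; ring
    have p : 0 ≤ 2 / δ * (ε * σa x * μ x - δ / 2 * N) ^ 2 := by positivity
    have b : (ε * σa x) ^ 2 ≤ M ^ 2 := by
      refine pow_le_pow_left₀ (mul_nonneg hε.le (h.σa_bound x).1) ?_ 2
      nlinarith [(h.σa_bound x).1, (h.σa_bound x).2, h.eps_le]
    have c : 2 / δ * (ε * σa x * μ x) ^ 2 ≤ 2 * M ^ 2 / δ * μ x ^ 2 := by
      have := mul_le_mul_of_nonneg_left (mul_le_mul_of_nonneg_right b (sq_nonneg (μ x)))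
        (by positivity : 0 ≤ 2 / δ)
      calc _ = 2 / δ * ((ε * σa x) ^ 2 * μ x ^ 2) := by ring
        _ ≤ _ := this
        _ = _ := by ring
    linarith
  have h2 : 2 * A x * N ≤ δ / 2 * N ^ 2 + 2 / δ * A x ^ 2 := by
    have e : δ / 2 * N ^ 2 + 2 / δ * A x ^ 2 - 2 * A x * N
      = 2 / δ * (A x - δ / 2 * N) ^ 2 := by field_simp; ring
    have p : 0 ≤ 2 / δ * (A x - δ / 2 * N) ^ 2 := by positivity
    linarith
  have h3 := mul_le_mul_of_nonneg_left (add_le_add h1 h2) (sq_nonneg ε)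
  linarith

/-- The total squared residual of a kinetic error system. -/
noncomputable def residual (A μ : ℝ → ℝ) (F T : ℝ → ℝ → ℝ) : ℝ :=
  (∫ x in (0:ℝ)..1, A x ^ 2) + (∫ x in (0:ℝ)..1, μ x ^ 2)
    + (∫ x in (0:ℝ)..1, ∫ v in (-1:ℝ)..1, T x v ^ 2)
    + (∫ v in (0:ℝ)..1, F 0 v ^ 2) + ∫ v in (-1:ℝ)..0, F 1 v ^ 2

lemma residual_parts_nonneg (A μ : ℝ → ℝ) (F T : ℝ → ℝ → ℝ) :
    0 ≤ (∫ x in (0:ℝ)..1, A x ^ 2) ∧ 0 ≤ (∫ x in (0:ℝ)..1, μ x ^ 2) ∧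
      0 ≤ (∫ x in (0:ℝ)..1, ∫ v in (-1:ℝ)..1, T x v ^ 2) ∧
      0 ≤ (∫ v in (0:ℝ)..1, F 0 v ^ 2) ∧ 0 ≤ ∫ v in (-1:ℝ)..0, F 1 v ^ 2 :=
  ⟨intervalIntegral.integral_nonneg zero_le_one fun _ _ => sq_nonneg _,
    intervalIntegral.integral_nonneg zero_le_one fun _ _ => sq_nonneg _,
    intervalIntegral.integral_nonneg zero_le_one fun _ _ =>
      intervalIntegral.integral_nonneg (by norm_num) fun _ _ => sq_nonneg _,
    intervalIntegral.integral_nonneg zero_le_one fun _ _ => sq_nonneg _,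
    intervalIntegral.integral_nonneg (by norm_num) fun _ _ => sq_nonneg _⟩

lemma sq_second_moment_le {u : ℝ → ℝ} (hu : Continuous u) :
    2 * (1 / 2 * ∫ v in (-1:ℝ)..1, v ^ 2 * u v) ^ 2 ≤ ∫ v in (-1:ℝ)..1, v ^ 4 * u v ^ 2 := by
  have h := sq_integral_le (by norm_num : (-1:ℝ) ≤ 1) (u := fun v => v ^ 2 * u v) (by fun_prop)
  have e : ∀ v, (v ^ 2 * u v) ^ 2 = v ^ 4 * u v ^ 2 := fun v => by ring
  simp only [e] at h
  linarith

lemma fourth_moment_le_left {u : ℝ → ℝ} (hu : Continuous u) :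
    ∫ v in (-1:ℝ)..1, v ^ 4 * u v ^ 2
      ≤ -(∫ v in (-1:ℝ)..1, v * u v ^ 2) + 2 * ∫ v in (0:ℝ)..1, u v ^ 2 := by
  have hneg : ∫ v in (-1:ℝ)..0, v ^ 4 * u v ^ 2 ≤ ∫ v in (-1:ℝ)..0, -(v * u v ^ 2) :=
    intervalIntegral.integral_mono_on (by norm_num)
      (Continuous.intervalIntegrable (by fun_prop) _ _)
      (Continuous.intervalIntegrable (by fun_prop) _ _) fun v hv => by
        have h1 : 0 ≤ -v := neg_nonneg.2 hv.2
        have : (-v) ^ 4 ≤ (-v) ^ 1 :=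
          pow_le_pow_of_le_one h1 (by linarith [hv.1]) (by norm_num)
        rw [Even.neg_pow (by decide), pow_one] at this
        nlinarith [mul_le_mul_of_nonneg_right this (sq_nonneg (u v))]
  have hpos : ∫ v in (0:ℝ)..1, v ^ 4 * u v ^ 2
      ≤ ∫ v in (0:ℝ)..1, (-(v * u v ^ 2) + 2 * u v ^ 2) :=
    intervalIntegral.integral_mono_on (by norm_num)
      (Continuous.intervalIntegrable (by fun_prop) _ _)
      (Continuous.intervalIntegrable (by fun_prop) _ _) fun v hv => by
        have : v ^ 4 ≤ 1 := pow_le_one₀ hv.1 hv.2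
        nlinarith [mul_le_mul_of_nonneg_right this (sq_nonneg (u v)),
          mul_le_mul_of_nonneg_right hv.2 (sq_nonneg (u v))]
  rw [intervalIntegral.integral_add (Continuous.intervalIntegrable (by fun_prop) _ _)
    (Continuous.intervalIntegrable (by fun_prop) _ _), intervalIntegral.integral_const_mul] at hpos
  have s₁ := intervalIntegral.integral_add_adjacent_intervals
    (f := fun v => v ^ 4 * u v ^ 2) (μ := volume) (a := -1) (b := 0) (c := 1)
    (Continuous.intervalIntegrable (by fun_prop) _ _)
    (Continuous.intervalIntegrable (by fun_prop) _ _)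
  have s₂ := intervalIntegral.integral_add_adjacent_intervals
    (f := fun v => -(v * u v ^ 2)) (μ := volume) (a := -1) (b := 0) (c := 1)
    (Continuous.intervalIntegrable (by fun_prop) _ _)
    (Continuous.intervalIntegrable (by fun_prop) _ _)
  rw [← s₁, ← intervalIntegral.integral_neg, ← s₂]
  linarith

lemma fourth_moment_le_right {u : ℝ → ℝ} (hu : Continuous u) :
    ∫ v in (-1:ℝ)..1, v ^ 4 * u v ^ 2
      ≤ (∫ v in (-1:ℝ)..1, v * u v ^ 2) + 2 * ∫ v in (-1:ℝ)..0, u v ^ 2 := by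
  have h := fourth_moment_le_left (u := fun v => u (-v)) (by fun_prop)
  have e₁ := intervalIntegral.integral_comp_neg (a := -1) (b := 1) fun v => v ^ 4 * u v ^ 2
  have e₂ := intervalIntegral.integral_comp_neg (a := -1) (b := 1) fun v => v * u v ^ 2
  have e₃ := intervalIntegral.integral_comp_neg (a := 0) (b := 1) fun v => u v ^ 2
  have p : ∀ v : ℝ, (-v) ^ 4 = v ^ 4 := fun v => by ring
  simp only [neg_neg, p, neg_mul, intervalIntegral.integral_neg, neg_zero] at e₁ e₂ e₃
  rw [e₁, e₃] at h
  linarith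

/-- Global energy estimate: the boundary second moments and the kinetic fluctuation are controlled
by the residual and a small multiple of the average density. -/
lemma energy_estimate (h : KineticErrorSystem ε m M σs σa A μ F F' T) {δ : ℝ} (hδ : 0 < δ) :
    (1 / 2 * ∫ v in (-1:ℝ)..1, v ^ 2 * F 0 v) ^ 2 + (1 / 2 * ∫ v in (-1:ℝ)..1, v ^ 2 * F 1 v) ^ 2
        ≤ (1 / (2 * m) + 2 * M ^ 2 / δ + 2 / δ + 1) * residual A μ F T
          + δ * ∫ x in (0:ℝ)..1, vavg F x ^ 2 ∧
      m / 2 * (∫ x in (0:ℝ)..1, ∫ v in (-1:ℝ)..1, (F x v - vavg F x) ^ 2)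
        ≤ (1 / (2 * m) + 2 * M ^ 2 / δ + 2 / δ + 1) * residual A μ F T
          + δ * ∫ x in (0:ℝ)..1, vavg F x ^ 2 := by
  have hF := h.F_cont
  have hF' := h.F'_cont
  have hT := h.T_cont
  have hN := h.vavg_cont
  have hA := h.A_cont
  have hμ := h.μ_cont
  have hε := h.eps_pos
  have hε1 := h.eps_le
  have hm := h.m_pos
  have hFTC : ∫ x in (0:ℝ)..1, ∫ v in (-1:ℝ)..1, v * (F x v * F' x v)
      = 1 / 2 * (∫ v in (-1:ℝ)..1, v * F 1 v ^ 2) - 1 / 2 * ∫ v in (-1:ℝ)..1, v * F 0 v ^ 2 :=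
    intervalIntegral.integral_eq_sub_of_hasDerivAt
      (f := fun x => 1 / 2 * ∫ v in (-1:ℝ)..1, v * F x v ^ 2) (fun x _ =>
      ((hasDerivAt_integral_of_continuous (F := fun y v => v * F y v ^ 2)
        (F' := fun y v => 2 * (v * (F y v * F' y v))) (by fun_prop) (by fun_prop)
        (fun y v => (((h.hasDerivAt y v).pow 2).const_mul v).congr_deriv
          (by push_cast; ring)) (-1) 1 x).const_mul _).congr_deriv
        (by rw [intervalIntegral.integral_const_mul]; ring))
      (Continuous.intervalIntegrable (by fun_prop) _ _)
  have key := integral_le_lincomb zero_le_one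
    (f := fun x => ε * ∫ v in (-1:ℝ)..1, v * (F x v * F' x v))
    (u₁ := fun x => ∫ v in (-1:ℝ)..1, (F x v - vavg F x) ^ 2)
    (u₂ := fun x => ∫ v in (-1:ℝ)..1, T x v ^ 2) (u₃ := fun x => μ x ^ 2) (u₄ := fun x => A x ^ 2)
    (u₅ := fun x => vavg F x ^ 2)
    (-(m / 2)) (ε ^ 2 * (1 / (2 * m))) (ε ^ 2 * (2 * M ^ 2 / δ)) (ε ^ 2 * (2 / δ)) (ε ^ 2 * δ)
    (by fun_prop) (by fun_prop) (by fun_prop) (by fun_prop) (by fun_prop) (by fun_prop)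
    (fun x _ => by linarith [h.local_energy hδ x])
  rw [intervalIntegral.integral_const_mul, hFTC] at key
  have hl := (sq_second_moment_le (h.F_slice 0)).trans (fourth_moment_le_left (h.F_slice 0))
  have hr := (sq_second_moment_le (h.F_slice 1)).trans (fourth_moment_le_right (h.F_slice 1))
  obtain ⟨hA0, hμ0, hT0, hb0, hb1⟩ := residual_parts_nonneg A μ F T
  obtain ⟨hn0, -, hV0, -, -⟩ := residual_parts_nonneg (vavg F) μ F fun x v => F x v - vavg F x
  unfold residual
  generalize (∫ x in (0:ℝ)..1, A x ^ 2) = eA at *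
  generalize (∫ x in (0:ℝ)..1, μ x ^ 2) = eμ at *
  generalize (∫ x in (0:ℝ)..1, ∫ v in (-1:ℝ)..1, T x v ^ 2) = eT at *
  generalize (∫ x in (0:ℝ)..1, ∫ v in (-1:ℝ)..1, (F x v - vavg F x) ^ 2) = V at *
  generalize (∫ x in (0:ℝ)..1, vavg F x ^ 2) = n at *
  generalize (∫ v in (0:ℝ)..1, F 0 v ^ 2) = b₀ at *
  generalize (∫ v in (-1:ℝ)..0, F 1 v ^ 2) = b₁ at *
  generalize (∫ v in (-1:ℝ)..1, v * F 0 v ^ 2) = K₀ at *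
  generalize (∫ v in (-1:ℝ)..1, v * F 1 v ^ 2) = K₁ at *
  generalize (1 / 2 * ∫ v in (-1:ℝ)..1, v ^ 2 * F 0 v) = P₀ at *
  generalize (1 / 2 * ∫ v in (-1:ℝ)..1, v ^ 2 * F 1 v) = P₁ at *
  have c₁ : 0 ≤ 1 / (2 * m) := by positivity
  have c₂ : 0 ≤ 2 * M ^ 2 / δ := by positivity
  have c₃ : 0 ≤ 2 / δ := by positivity
  generalize 1 / (2 * m) = c at *
  generalize 2 * M ^ 2 / δ = c' at *
  generalize 2 / δ = c'' at *
  set Y := c * eT + c' * eμ + c'' * eA + δ * n with hY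
  have hY0 : 0 ≤ Y := by positivity
  have hYX : Y + b₀ + b₁ ≤ (c + c' + c'' + 1) * (eA + eμ + eT + b₀ + b₁) + δ * n := by
    have : 0 ≤ c * (eA + eμ + b₀ + b₁) + c' * (eA + eT + b₀ + b₁)
      + c'' * (eμ + eT + b₀ + b₁) + (eA + eμ + eT) := by positivity
    rw [hY]; linarith
  have key' : ε * (1 / 2 * K₁ - 1 / 2 * K₀) + m / 2 * V ≤ ε ^ 2 * Y := by rw [hY]; linarith
  have hmV : 0 ≤ m / 2 * V := by positivity
  have hεY : ε * Y ≤ Y := by nlinarith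
  refine ⟨le_trans ?_ hYX, le_trans ?_ hYX⟩
  · have : 1 / 2 * K₁ - 1 / 2 * K₀ ≤ ε * Y := by
      refine le_of_mul_le_mul_left ?_ hε
      linarith
    linarith
  · have h1 : -(b₀ + b₁) ≤ 1 / 2 * K₁ - 1 / 2 * K₀ := by nlinarith [sq_nonneg P₀, sq_nonneg P₁]
    have h2 := mul_le_mul_of_nonneg_left h1 hε.le
    have h3 : ε * (b₀ + b₁) ≤ b₀ + b₁ := by nlinarith
    have h4 : ε * (ε * Y) ≤ ε * Y := mul_le_mul_of_nonneg_left hεY hε.le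
    linarith

/-- Pointwise control of the closure defect `⟨F⟩ - 3⟨v² F⟩` by the kinetic fluctuation. -/
lemma closure_defect_le {u : ℝ → ℝ} (hu : Continuous u) (N : ℝ) :
    (N - 3 * (1 / 2 * ∫ v in (-1:ℝ)..1, v ^ 2 * u v)) ^ 2
      ≤ 5 * ∫ v in (-1:ℝ)..1, (u v - N) ^ 2 := by
  have hw := sq_second_moment_le (u := fun v => u v - N) (by fun_prop)
  have e : ∫ v in (-1:ℝ)..1, v ^ 2 * (u v - N) = (∫ v in (-1:ℝ)..1, v ^ 2 * u v) - 2 / 3 * N := by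
    simp only [mul_sub]
    rw [intervalIntegral.integral_sub (Continuous.intervalIntegrable (by fun_prop) _ _)
      (Continuous.intervalIntegrable (by fun_prop) _ _), intervalIntegral.integral_mul_const,
      integral_pow]
    norm_num
  have hle : ∫ v in (-1:ℝ)..1, v ^ 4 * (u v - N) ^ 2 ≤ ∫ v in (-1:ℝ)..1, (u v - N) ^ 2 :=
    intervalIntegral.integral_mono_on (by norm_num)
      (Continuous.intervalIntegrable (by fun_prop) _ _)
      (Continuous.intervalIntegrable (by fun_prop) _ _) fun v hv => by
        have h1 : v ^ 2 ≤ 1 := by nlinarith [hv.1, hv.2]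
        have : v ^ 4 ≤ 1 := by nlinarith [sq_nonneg v]
        nlinarith [mul_le_mul_of_nonneg_right this (sq_nonneg (u v - N))]
  have h0 : 0 ≤ ∫ v in (-1:ℝ)..1, (u v - N) ^ 2 :=
    intervalIntegral.integral_nonneg (by norm_num) fun v _ => sq_nonneg _
  rw [e] at hw
  nlinarith

lemma sq_first_moment_le {u : ℝ → ℝ} (hu : Continuous u) :
    (1 / 2 * ∫ v in (-1:ℝ)..1, v * u v) ^ 2 ≤ ∫ v in (-1:ℝ)..1, u v ^ 2 := by
  have h := sq_integral_le (by norm_num : (-1:ℝ) ≤ 1) (u := fun v => v * u v) (by fun_prop)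
  have hle : ∫ v in (-1:ℝ)..1, (v * u v) ^ 2 ≤ ∫ v in (-1:ℝ)..1, u v ^ 2 :=
    intervalIntegral.integral_mono_on (by norm_num)
      (Continuous.intervalIntegrable (by fun_prop) _ _)
      (Continuous.intervalIntegrable (by fun_prop) _ _) fun v hv => by
        have h1 : v ^ 2 ≤ 1 := by nlinarith [hv.1, hv.2]
        nlinarith [mul_le_mul_of_nonneg_right h1 (sq_nonneg (u v))]
  have h0 : 0 ≤ ∫ v in (-1:ℝ)..1, u v ^ 2 :=
    intervalIntegral.integral_nonneg (by norm_num) fun v _ => sq_nonneg _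
  nlinarith

lemma integral_sq_split {u : ℝ → ℝ} (hu : Continuous u) (N : ℝ)
    (hN : ∫ v in (-1:ℝ)..1, u v = 2 * N) :
    ∫ v in (-1:ℝ)..1, u v ^ 2 = (∫ v in (-1:ℝ)..1, (u v - N) ^ 2) + 2 * N ^ 2 := by
  have := integral_eq_lincomb (by norm_num : (-1:ℝ) ≤ 1) (f := fun v => (u v - N) ^ 2)
    (u₁ := fun v => u v ^ 2) (u₂ := u) (u₃ := fun _ => 1) (u₄ := fun _ => 0) (u₅ := fun _ => 0)
    1 (-2 * N) (N ^ 2) 0 0 (by fun_prop) (by fun_prop) hu (by fun_prop) (by fun_prop)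
    (by fun_prop) (fun v _ => by ring)
  simp only [hN, intervalIntegral.integral_const, smul_eq_mul] at this
  linarith

/-- The source of the continuity equation, written in terms of the second moment. -/
lemma integral_sq_source_le (h : KineticErrorSystem ε m M σs σa A μ F F' T) :
    ∫ x in (0:ℝ)..1, (-(σa x * (vavg F x - 3 * (1 / 2 * ∫ v in (-1:ℝ)..1, v ^ 2 * F x v)))
        + ε * σa x * μ x + A x) ^ 2
      ≤ 15 * M ^ 2 * (∫ x in (0:ℝ)..1, ∫ v in (-1:ℝ)..1, (F x v - vavg F x) ^ 2)
        + 3 * M ^ 2 * (∫ x in (0:ℝ)..1, μ x ^ 2) + 3 * ∫ x in (0:ℝ)..1, A x ^ 2 := by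
  have hF := h.F_cont
  have hN := h.vavg_cont
  have hA := h.A_cont
  have hμ := h.μ_cont
  have hσa := h.σa_cont
  have key := integral_le_lincomb zero_le_one
    (f := fun x => (-(σa x * (vavg F x - 3 * (1 / 2 * ∫ v in (-1:ℝ)..1, v ^ 2 * F x v)))
        + ε * σa x * μ x + A x) ^ 2)
    (u₁ := fun x => ∫ v in (-1:ℝ)..1, (F x v - vavg F x) ^ 2) (u₂ := fun x => μ x ^ 2)
    (u₃ := fun x => A x ^ 2) (u₄ := fun _ => 0) (u₅ := fun _ => 0)
    (15 * M ^ 2) (3 * M ^ 2) 3 0 0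
    (by fun_prop) (by fun_prop) (by fun_prop) (by fun_prop) (by fun_prop) (by fun_prop)
    fun x _ => by
      have h1 : σa x ^ 2 ≤ M ^ 2 := pow_le_pow_left₀ (h.σa_bound x).1 (h.σa_bound x).2 2
      have h2 : (ε * σa x) ^ 2 ≤ M ^ 2 := by
        have := mul_le_mul_of_nonneg_right (pow_le_one₀ (n := 2) h.eps_pos.le h.eps_le)
          (sq_nonneg (σa x))
        rw [mul_pow]; linarith
      have h3 : ∀ p q r : ℝ, (-p + q + r) ^ 2 ≤ 3 * p ^ 2 + 3 * q ^ 2 + 3 * r ^ 2 :=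
        fun p q r => by nlinarith [sq_nonneg (p + q), sq_nonneg (p + r), sq_nonneg (q - r)]
      have h4 := h3 (σa x * (vavg F x - 3 * (1 / 2 * ∫ v in (-1:ℝ)..1, v ^ 2 * F x v)))
        (ε * σa x * μ x) (A x)
      have h5 := mul_le_mul h1 (closure_defect_le (h.F_slice x) (vavg F x))
        (sq_nonneg _) (sq_nonneg _)
      have h6 := mul_le_mul_of_nonneg_right h2 (sq_nonneg (μ x))
      rw [mul_pow, mul_pow (ε * σa x)] at h4
      linarith
  simpa only [intervalIntegral.integral_const, smul_eq_mul, mul_zero, add_zero] using key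

/-- The average density is controlled by the residual, the kinetic fluctuation and the boundary
second moments. -/
lemma exists_average_bound {m M : ℝ} (hm : 0 < m) (hM : 0 < M) :
    ∃ C > 0, ∀ (ε : ℝ) (σs σa A μ : ℝ → ℝ) (F F' T : ℝ → ℝ → ℝ),
      KineticErrorSystem ε m M σs σa A μ F F' T →
      ∫ x in (0:ℝ)..1, vavg F x ^ 2 ≤ C * (residual A μ F T
        + (∫ x in (0:ℝ)..1, ∫ v in (-1:ℝ)..1, (F x v - vavg F x) ^ 2)
        + ((1 / 2 * ∫ v in (-1:ℝ)..1, v ^ 2 * F 0 v) ^ 2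
          + (1 / 2 * ∫ v in (-1:ℝ)..1, v ^ 2 * F 1 v) ^ 2)) := by
  obtain ⟨C₀, hC₀, hdiff⟩ := exists_diffusion_bound hm (by positivity : 0 < 2 * M)
  refine ⟨18 * (C₀ * (4 + 15 * M ^ 2)) + 10, by positivity, ?_⟩
  intro ε σs σa A μ F F' T h
  have hF := h.F_cont
  have hT := h.T_cont
  have hN := h.vavg_cont
  have hA := h.A_cont
  have hμ := h.μ_cont
  have hσs := h.σs_cont
  have hσa := h.σa_cont
  have hε1 : ε ^ 2 ≤ 1 := pow_le_one₀ h.eps_pos.le h.eps_le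
  have hmain := hdiff (fun x => σs x + ε ^ 2 * σa x) σa
    (fun x => 1 / 2 * ∫ v in (-1:ℝ)..1, v ^ 2 * F x v)
    (fun y => 1 / (2 * ε) * ∫ v in (-1:ℝ)..1, v * F y v)
    (fun x => 1 / 2 * ∫ v in (-1:ℝ)..1, v * T x v)
    (fun x => -(σa x * (vavg F x - 3 * (1 / 2 * ∫ v in (-1:ℝ)..1, v ^ 2 * F x v)))
      + ε * σa x * μ x + A x)
    (by fun_prop) (by fun_prop) (by fun_prop) (by fun_prop)
    (fun x => ⟨by linarith [(h.σs_bound x).1, mul_nonneg (sq_nonneg ε) (h.σa_bound x).1],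
      by linarith [(h.σs_bound x).2, (h.σa_bound x).2,
        mul_le_mul_of_nonneg_right hε1 (h.σa_bound x).1]⟩)
    (fun x => ⟨(h.σa_bound x).1, by linarith [(h.σa_bound x).2]⟩)
    h.hasDerivAt_pressure
    (fun x => (h.hasDerivAt_flux x).congr_deriv (by ring))
  have hq : ∫ x in (0:ℝ)..1, (1 / 2 * ∫ v in (-1:ℝ)..1, v * T x v) ^ 2
      ≤ ∫ x in (0:ℝ)..1, ∫ v in (-1:ℝ)..1, T x v ^ 2 :=
    intervalIntegral.integral_mono_on zero_le_one
      (Continuous.intervalIntegrable (by fun_prop) _ _)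
      (Continuous.intervalIntegrable (by fun_prop) _ _) fun x _ => sq_first_moment_le (h.T_slice x)
  have hs := h.integral_sq_source_le
  have hn : ∫ x in (0:ℝ)..1, vavg F x ^ 2 ≤ _ :=
    integral_le_lincomb zero_le_one
      (u₁ := fun x => (1 / 2 * ∫ v in (-1:ℝ)..1, v ^ 2 * F x v) ^ 2)
      (u₂ := fun x => ∫ v in (-1:ℝ)..1, (F x v - vavg F x) ^ 2)
      (u₃ := fun _ => 0) (u₄ := fun _ => 0) (u₅ := fun _ => 0) 18 10 0 0 0
      (by fun_prop) (by fun_prop) (by fun_prop) (by fun_prop) (by fun_prop) (by fun_prop)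
      fun x _ => by
        nlinarith [closure_defect_le (h.F_slice x) (vavg F x),
          sq_nonneg (vavg F x - 6 * (1 / 2 * ∫ v in (-1:ℝ)..1, v ^ 2 * F x v))]
  obtain ⟨hA0, hμ0, hT0, hb₀, hb₁⟩ := residual_parts_nonneg A μ F T
  have hV0 := (residual_parts_nonneg A μ F fun x v => F x v - vavg F x).2.2.1
  simp only [intervalIntegral.integral_const, smul_eq_mul, mul_zero, add_zero] at hn
  unfold residual
  set B := (1 / 2 * ∫ v in (-1:ℝ)..1, v ^ 2 * F 0 v) ^ 2
    + (1 / 2 * ∫ v in (-1:ℝ)..1, v ^ 2 * F 1 v) ^ 2 with hB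
  have hB0 : 0 ≤ B := by positivity
  generalize (∫ x in (0:ℝ)..1, A x ^ 2) = eA at *
  generalize (∫ x in (0:ℝ)..1, μ x ^ 2) = eμ at *
  generalize (∫ x in (0:ℝ)..1, ∫ v in (-1:ℝ)..1, T x v ^ 2) = eT at *
  generalize (∫ x in (0:ℝ)..1, ∫ v in (-1:ℝ)..1, (F x v - vavg F x) ^ 2) = V at *
  generalize (∫ v in (0:ℝ)..1, F 0 v ^ 2) = b₀ at *
  generalize (∫ v in (-1:ℝ)..0, F 1 v ^ 2) = b₁ at *
  have hsum : eT + (15 * M ^ 2 * V + 3 * M ^ 2 * eμ + 3 * eA) + B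
      ≤ (4 + 15 * M ^ 2) * (eA + eμ + eT + b₀ + b₁ + V + B) := by
    have : 0 ≤ eA + 4 * eμ + 3 * eT + 4 * (b₀ + b₁ + V) + 3 * B
      + M ^ 2 * (15 * eA + 12 * eμ + 15 * (eT + b₀ + b₁ + B)) := by positivity
    linarith
  have hP := hmain.trans (mul_le_mul_of_nonneg_left
    ((add_le_add (add_le_add hq hs) le_rfl).trans hsum) hC₀.le)
  linarith

/-- Uniform `L²` stability of the kinetic error system. -/
lemma exists_uniform_bound {m M : ℝ} (hm : 0 < m) (hM : 0 < M) :
    ∃ C > 0, ∀ (ε : ℝ) (σs σa A μ : ℝ → ℝ) (F F' T : ℝ → ℝ → ℝ),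
      KineticErrorSystem ε m M σs σa A μ F F' T →
      ∫ x in (0:ℝ)..1, ∫ v in (-1:ℝ)..1, F x v ^ 2 ≤ C * residual A μ F T := by
  obtain ⟨K, hK, havg⟩ := exists_average_bound hm hM
  set k := K * (2 / m + 1) with hk
  have hk0 : 0 < k := by positivity
  set δ := 1 / (2 * k) with hδd
  have hδ : 0 < δ := by positivity
  set c := 1 / (2 * m) + 2 * M ^ 2 / δ + 2 / δ + 1 with hc
  have hc0 : 0 < c := by positivity
  have hkδ : k * δ = 1 / 2 := by rw [hδd]; field_simp
  set R := 2 * (K + k * c) with hR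
  have hR0 : 0 < R := by positivity
  refine ⟨2 / m * (c + δ * R) + 2 * R, by positivity, ?_⟩
  intro ε σs σa A μ F F' T h
  obtain ⟨hP, hV⟩ := h.energy_estimate hδ
  rw [← hc] at hP hV
  have hF := h.F_cont
  have hN := h.vavg_cont
  have hn := havg _ _ _ _ _ _ _ _ h
  have hF2 : ∫ x in (0:ℝ)..1, ∫ v in (-1:ℝ)..1, F x v ^ 2 = _ :=
    integral_eq_lincomb zero_le_one
      (u₁ := fun x => ∫ v in (-1:ℝ)..1, (F x v - vavg F x) ^ 2) (u₂ := fun x => vavg F x ^ 2)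
      (u₃ := fun _ => 0) (u₄ := fun _ => 0) (u₅ := fun _ => 0) 1 2 0 0 0
      (by fun_prop) (by fun_prop) (by fun_prop) (by fun_prop) (by fun_prop) (by fun_prop)
      fun x _ => by rw [integral_sq_split (h.F_slice x) _ (integral_F F x)]; ring
  simp only [zero_mul, add_zero] at hF2
  rw [hF2]
  generalize residual A μ F T = E at *
  generalize (∫ x in (0:ℝ)..1, ∫ v in (-1:ℝ)..1, (F x v - vavg F x) ^ 2) = V at *
  generalize (∫ x in (0:ℝ)..1, vavg F x ^ 2) = n at *
  set X := c * E + δ * n with hX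
  have hV' : V ≤ 2 / m * X := by
    have := mul_le_mul_of_nonneg_left hV (by positivity : 0 ≤ 2 / m)
    have e : 2 / m * (m / 2 * V) = V := by field_simp
    rwa [e] at this
  have hnX : n ≤ K * E + k * X := by
    have := hn.trans (mul_le_mul_of_nonneg_left (add_le_add (add_le_add le_rfl hV') hP) hK.le)
    rw [hk]; linarith
  have hnE : n ≤ R * E := by
    have e : k * X = k * c * E + 1 / 2 * n := by rw [hX, ← hkδ]; ring
    rw [hR]; linarith
  have hXE : X ≤ (c + δ * R) * E := by
    have := mul_le_mul_of_nonneg_left hnE hδ.le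
    rw [hX]; linarith
  have hXm := mul_le_mul_of_nonneg_left hXE (by positivity : 0 ≤ 2 / m)
  linarith

end KineticErrorSystem

/-- A continuous function on the unit interval with prescribed bounds extends to a continuous
function on the line with the same bounds. -/
lemma exists_continuous_extension_s13 {σ : ℝ → ℝ} {c d : ℝ} (hσ : ContinuousOn σ (Icc 0 1))
    (hb : ∀ x ∈ Icc (0:ℝ) 1, c ≤ σ x ∧ σ x ≤ d) :
    ∃ s : ℝ → ℝ, Continuous s ∧ (∀ x, c ≤ s x ∧ s x ≤ d) ∧ ∀ x ∈ Icc (0:ℝ) 1, σ x = s x :=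
  ⟨fun x => σ (projIcc 0 1 zero_le_one x),
    hσ.comp_continuous (continuous_subtype_val.comp (continuous_projIcc (h := zero_le_one)))
      fun x => Subtype.prop _,
    fun x => hb _ (Subtype.prop _), fun x hx => by simp [projIcc_of_mem zero_le_one hx]⟩

/-- The macro–micro residuals of a pair `(r, h)` with homogeneous data define a kinetic error
system for `r + ε h`. -/
lemma KineticErrorSystem.of_residuals {ε m M : ℝ} {σs σa r r' : ℝ → ℝ} {h h' : ℝ → ℝ → ℝ}
    (hε : 0 < ε) (hε1 : ε ≤ 1) (hm : 0 < m) (hM : 0 < M)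
    (hσs : Continuous σs) (hσa : Continuous σa)
    (hσsb : ∀ x, m ≤ σs x ∧ σs x ≤ M) (hσab : ∀ x, 0 ≤ σa x ∧ σa x ≤ M)
    (hr' : Continuous r') (hr : ∀ x, HasDerivAt r (r' x) x)
    (hh : Continuous (uncurry h)) (hh' : Continuous (uncurry h'))
    (hd : ∀ x v, HasDerivAt (fun y => h y v) (h' x v) x) :
    KineticErrorSystem ε m M σs σa
      (fun x => (1/2) * (∫ v in (-1:ℝ)..1, v * h' x v) + σa x * r x) (vavg h)
      (fun x v => r x + ε * h x v) (fun x v => r' x + ε * h' x v)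
      (fun x v => v * (r' x + ε * h' x v) - ε * ((1/2) * ∫ w in (-1:ℝ)..1, w * h' x w)
        - σs x * (vavg h x - h x v) + ε ^ 2 * σa x * h x v) := by
  have hrc : Continuous r := continuous_iff_continuousAt.2 fun x => (hr x).continuousAt
  have hx : ∀ x, Continuous (h x) := fun x => hh.comp (by fun_prop : Continuous fun v => (x, v))
  have hx' : ∀ x, Continuous (h' x) := fun x => hh'.comp (by fun_prop : Continuous fun v => (x, v))
  have hN : Continuous (vavg h) := by unfold vavg; fun_prop
  have hJ : Continuous fun x => ∫ v in (-1:ℝ)..1, v * h' x v := by fun_prop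
  refine ⟨hε, hε1, hm, hM, hσs, hσa, by fun_prop, hN, by fun_prop, by fun_prop, by fun_prop,
    hσsb, hσab, fun x v => (hr x).add ((hd x v).const_mul ε), fun x v => ?_, fun x => ?_⟩
  · have hF : vavg (fun x v => r x + ε * h x v) x = r x + ε * vavg h x := by
      have := hx x
      unfold vavg
      rw [intervalIntegral.integral_add (by simp)
        ((by fun_prop : Continuous fun v => ε * h x v).intervalIntegrable _ _),
        intervalIntegral.integral_const, intervalIntegral.integral_const_mul, smul_eq_mul]
      ring
    rw [hF]
    ring
  · have h1 := hx x
    have h2 := hx' x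
    have hI : ∫ v in (-1:ℝ)..1, h x v = 2 * vavg h x := by unfold vavg; ring
    have := integral_eq_lincomb (a := -1) (b := 1) (by norm_num)
      (f := fun v => v * (r' x + ε * h' x v) - ε * ((1/2) * ∫ w in (-1:ℝ)..1, w * h' x w)
        - σs x * (vavg h x - h x v) + ε ^ 2 * σa x * h x v)
      (u₁ := fun v => v) (u₂ := fun v => v * h' x v) (u₃ := fun _ => 1) (u₄ := h x)
      (u₅ := fun _ => 0) (r' x) ε
      (-(ε * ((1/2) * ∫ w in (-1:ℝ)..1, w * h' x w)) - σs x * vavg h x)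
      (σs x + ε ^ 2 * σa x) 0 (by fun_prop) (by fun_prop) (by fun_prop) (by fun_prop) h1
      (by fun_prop) fun v _ => by ring
    rw [vavg, this, hI, integral_id, intervalIntegral.integral_const, smul_eq_mul]
    ring

/-- A `C¹` function on the unit interval extends to a `C¹` function on the line. -/
lemma exists_C1_extension {ρ : ℝ → ℝ} (hρ : ContDiffOn ℝ 1 ρ (Icc 0 1)) :
    ∃ r r' : ℝ → ℝ, Continuous r' ∧ (∀ x, HasDerivAt r (r' x) x) ∧
      ∀ x ∈ Icc (0:ℝ) 1, ρ x = r x := by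
  have hC : C1Omega fun x _ => ρ x := hρ.comp contDiff_fst.contDiffOn fun _ hp => hp.1
  obtain ⟨h, h', -, hh', hd, he⟩ := hC.exists_extension
  exact ⟨fun x => h x 0, fun x => h' x 0, hh'.comp (by fun_prop : Continuous fun x => (x, (0:ℝ))),
    fun x => hd x 0, fun x hx => he x hx 0 (by norm_num)⟩

lemma vavg_congr {g h : ℝ → ℝ → ℝ} {x : ℝ} (he : ∀ v ∈ Icc (-1:ℝ) 1, g x v = h x v) :
    vavg g x = vavg h x := by
  unfold vavg
  rw [intervalIntegral.integral_congr fun v hv => he v (by rwa [uIcc_of_le (by norm_num)] at hv)]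

/-- Derivatives at interior points are determined by an extension. -/
lemma deriv_eq_of_eqOn_Icc {f h : ℝ → ℝ} {d x : ℝ} (hx : x ∈ Ioo (0:ℝ) 1)
    (he : ∀ y ∈ Icc (0:ℝ) 1, f y = h y) (hd : HasDerivAt h d x) : deriv f x = d :=
  (hd.congr_of_eventuallyEq
    (Filter.eventually_of_mem (Icc_mem_nhds hx.1 hx.2) he)).deriv

/-- The flux divergence at interior points, computed from an extension. -/
lemma flux_deriv_eq {g h h' : ℝ → ℝ → ℝ} {x : ℝ} (hx : x ∈ Ioo (0:ℝ) 1)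
    (hd : ∀ x v, HasDerivAt (fun y => h y v) (h' x v) x)
    (he : ∀ x ∈ Icc (0:ℝ) 1, ∀ v ∈ Icc (-1:ℝ) 1, g x v = h x v) :
    ∫ v in (-1:ℝ)..1, v * deriv (fun y => g y v) x = ∫ v in (-1:ℝ)..1, v * h' x v := by
  refine intervalIntegral.integral_congr fun v hv => ?_
  rw [uIcc_of_le (by norm_num)] at hv
  simp only [deriv_eq_of_eqOn_Icc hx (fun y hy => he y hy v hv) (hd x v)]

/-- Uniform stability of the macro–micro PINN loss for isotropic (`v`-independent)
boundary data `φ(0,v) = a`, `φ(1,v) = b`: there are `C > 0` and `ε₀ ∈ (0,1]` such that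
for every `ε ∈ (0,ε₀]`, every exact macro–micro solution `(ρ*, g*)` and every `C¹` pair
`(ρ,g)`, `‖f − f*‖²_{L²(Ω)} ≤ C · E(ρ,g)` — uniformly in the Knudsen number. -/
theorem loss_stability_isotropic_bc (σmin σmax : ℝ) (hσmin : 0 < σmin) (hσ : σmin ≤ σmax)
    (σs σa G : ℝ → ℝ) (a b : ℝ) (φ : ℝ → ℝ → ℝ)
    (hσs : ∀ x ∈ Icc (0:ℝ) 1, σmin ≤ σs x ∧ σs x ≤ σmax)
    (hσa : ∀ x ∈ Icc (0:ℝ) 1, 0 ≤ σa x ∧ σa x ≤ σmax)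
    (hσsc : ContinuousOn σs (Icc 0 1)) (hσac : ContinuousOn σa (Icc 0 1))
    (hGc : ContinuousOn G (Icc 0 1))
    (hφ0 : ∀ v ∈ Ioc (0:ℝ) 1, φ 0 v = a)
    (hφ1 : ∀ v ∈ Ico (-1:ℝ) 0, φ 1 v = b) :
    ∃ C > 0, ∃ ε₀ ∈ Ioc (0:ℝ) 1, ∀ ε ∈ Ioc (0:ℝ) ε₀,
      ∀ ρs : ℝ → ℝ, ∀ gs : ℝ → ℝ → ℝ,
        ContDiffOn ℝ 1 ρs (Icc 0 1) → C1Omega gs →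
        (∀ x ∈ Icc (0:ℝ) 1, vavg gs x = 0) →
        SolvesMM ε σs σa G φ ρs gs →
        ∀ ρ : ℝ → ℝ, ∀ g : ℝ → ℝ → ℝ,
          ContDiffOn ℝ 1 ρ (Icc 0 1) → C1Omega g →
          (∫ x in (0:ℝ)..1, ∫ v in (-1:ℝ)..1,
              ((ρ x + ε * g x v) - (ρs x + ε * gs x v)) ^ 2)
            ≤ C * Eloss ε σs σa G φ ρ g := by
  have hσmax := hσmin.trans_le hσ
  obtain ⟨C, hC, hbound⟩ := KineticErrorSystem.exists_uniform_bound hσmin hσmax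
  refine ⟨C, hC, 1, by norm_num,
    fun ε hε ρs gs hρs hgs hgs0 hsol ρ g hρ hg => ?_⟩
  obtain ⟨flux_eq, micro_eq, bdry0, bdry1⟩ := hsol
  obtain ⟨s, hs, hsb, hse⟩ := exists_continuous_extension_s13 hσsc hσs
  obtain ⟨α, hα, hαb, hαe⟩ := exists_continuous_extension_s13 hσac hσa
  obtain ⟨r, r', hr', hrd, hre⟩ := exists_C1_extension hρ
  obtain ⟨q, q', hq', hqd, hqe⟩ := exists_C1_extension hρs
  obtain ⟨h, h', hh, hh', hhd, hhe⟩ := hg.exists_extension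
  obtain ⟨k, k', hk, hk', hkd, hke⟩ := hgs.exists_extension
  have slice : ∀ {u : ℝ → ℝ → ℝ}, Continuous (uncurry u) → ∀ x, Continuous (u x) :=
    fun hu x => hu.comp (by fun_prop : Continuous fun v => (x, v))
  have key := hbound _ _ _ _ _ _ _ _ (KineticErrorSystem.of_residuals
    (r := fun x => r x - q x) (r' := fun x => r' x - q' x)
    (h := fun x v => h x v - k x v) (h' := fun x v => h' x v - k' x v)
    hε.1 hε.2 hσmin hσmax hs hα hsb hαb (hr'.sub hq') (fun x => (hrd x).sub (hqd x))
    (hh.sub hk) (hh'.sub hk') fun x v => (hhd x v).sub (hkd x v))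
  have hJ : ∀ x, ∫ v in (-1:ℝ)..1, v * (h' x v - k' x v)
      = (∫ v in (-1:ℝ)..1, v * h' x v) - ∫ v in (-1:ℝ)..1, v * k' x v := fun x => by
    have := slice hh' x
    have := slice hk' x
    simp only [mul_sub]
    exact intervalIntegral.integral_sub (Continuous.intervalIntegrable (by fun_prop) _ _)
      (Continuous.intervalIntegrable (by fun_prop) _ _)
  have hV : ∀ x ∈ Icc (0:ℝ) 1, vavg (fun x v => h x v - k x v) x = vavg g x := fun x hx => by
    have e : vavg (fun x v => h x v - k x v) x = vavg h x - vavg k x := by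
      unfold vavg
      rw [intervalIntegral.integral_sub ((slice hh x).intervalIntegrable _ _)
        ((slice hk x).intervalIntegrable _ _)]
      ring
    rw [e, ← vavg_congr (hhe x hx), ← vavg_congr (hke x hx), hgs0 x hx, sub_zero]
  have h11 : (-1:ℝ) ≤ 1 := by norm_num
  have hm0 : (-1:ℝ) ≤ 0 := by norm_num
  have h0 : (0:ℝ) ∈ Icc (0:ℝ) 1 := by norm_num
  have h1 : (1:ℝ) ∈ Icc (0:ℝ) 1 := by norm_num
  convert key using 1
  · refine intervalIntegral.integral_congr fun x hx =>
      intervalIntegral.integral_congr fun v hv => ?_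
    rw [uIcc_of_le zero_le_one] at hx
    rw [uIcc_of_le h11] at hv
    simp only [hre x hx, hqe x hx, hhe x hx v hv, hke x hx v hv]
    ring
  · unfold Eloss KineticErrorSystem.residual
    have integrand : ∀ {x y : ℝ}, x = y → x ^ 2 = y ^ 2 := fun e => by rw [e]
    congr 2
    · congr 1
      · congr 1
        · congr 1
          · refine intervalIntegral.integral_congr_Ioo_of_le zero_le_one fun x hx => integrand ?_
            have hxI := Ioo_subset_Icc_self hx
            have hm := flux_eq x hxI
            rw [flux_deriv_eq hx hkd hke, hqe x hxI] at hm
            beta_reduce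
            rw [flux_deriv_eq hx hhd hhe, hJ, ← hαe x hxI, hre x hxI]
            linear_combination hm
          · refine intervalIntegral.integral_congr fun x hx => integrand ?_
            rw [uIcc_of_le zero_le_one] at hx
            exact (hV x hx).symm
        · refine intervalIntegral.integral_congr_Ioo_of_le zero_le_one fun x hx =>
            intervalIntegral.integral_congr (μ := volume) fun v hv => integrand ?_
          rw [uIcc_of_le h11] at hv
          have hxI := Ioo_subset_Icc_self hx
          have hm := micro_eq x hxI v hv
          rw [flux_deriv_eq hx hkd hke, hgs0 x hxI, hke x hxI v hv,
            deriv_eq_of_eqOn_Icc (h := fun y => q y + ε * k y v) hx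
              (fun y hy => by rw [hqe y hy, hke y hy v hv])
              ((hqd x).add ((hkd x v).const_mul ε))] at hm
          beta_reduce
          rw [flux_deriv_eq hx hhd hhe, hJ, hV x hxI, ← hαe x hxI, ← hse x hxI, hhe x hxI v hv,
            deriv_eq_of_eqOn_Icc (h := fun y => r y + ε * h y v) hx
              (fun y hy => by rw [hre y hy, hhe y hy v hv])
              ((hrd x).add ((hhd x v).const_mul ε))]
          linear_combination hm
      · refine intervalIntegral.integral_congr_Ioo_of_le zero_le_one fun v hv => integrand ?_
        have hvI : v ∈ Icc (-1:ℝ) 1 := ⟨by linarith [hv.1], hv.2.le⟩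
        have hb := bdry0 v (Ioo_subset_Ioc_self hv)
        rw [hqe 0 h0, hke 0 h0 v hvI] at hb
        rw [hre 0 h0, hhe 0 h0 v hvI]
        linear_combination hb
    · refine intervalIntegral.integral_congr_Ioo_of_le hm0 fun v hv => integrand ?_
      have hvI : v ∈ Icc (-1:ℝ) 1 := ⟨hv.1.le, by linarith [hv.2]⟩
      have hb := bdry1 v (Ioo_subset_Ico_self hv)
      rw [hqe 1 h1, hke 1 h1 v hvI] at hb
      rw [hre 1 h1, hhe 1 h1 v hvI]
      linear_combination hb
end
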